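/- arXiv:1008.1699 — 2 statements merged into one kernel-verified Lean document; each statement's English description precedes it below -/
import Mathlib

section
/- Let n ≥ 2. There exist constants R₀ > 0, C > 0 and K > 0, depending only on n, with the following property. Set R = R₀/4. For every λ ≥ 0, every smooth function u on B(0,2R₀) satisfying Δu + λu = 0 on B(0,2R₀) whose gradient does not vanish identically on the annulus A(R/8,R/4) = {x : R/8 ≤ |x| ≤ R/4}, and every r with 0 < r ≤ R/16, one has ‖∇u‖_{L²(B(0,2r))} ≤ e^{C√λ} · ( ‖∇u‖_{L²(B(0,5R/3))} / ‖∇u‖_{L²(A(R/8,R/4))} )^{K} · ‖∇u‖_{L²(B(0,r))}. -/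
open MeasureTheory Metric

/-- The Euclidean Laplacian `Δf = Σᵢ ∂²f/∂xᵢ²`. -/
noncomputable def eLap {n : ℕ} (f : EuclideanSpace ℝ (Fin n) → ℝ)
    (x : EuclideanSpace ℝ (Fin n)) : ℝ :=
  ∑ i : Fin n,
    fderiv ℝ (fun y => fderiv ℝ f y (EuclideanSpace.single i 1)) x (EuclideanSpace.single i 1)

/-- The `L²` norm of a function over a subset of `ℝⁿ`. -/
noncomputable def eL2On {n : ℕ} (g : EuclideanSpace ℝ (Fin n) → ℝ)
    (s : Set (EuclideanSpace ℝ (Fin n))) : ℝ :=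
  Real.sqrt (∫ x in s, (g x) ^ 2)

section

open scoped ContDiff

lemma hasDerivAt_max_zero_pow {k : ℕ} (hk : 1 ≤ k) (t : ℝ) :
    HasDerivAt (fun t : ℝ => (max 0 t) ^ (k + 1)) ((k + 1) * (max 0 t) ^ k) t := by
  rcases lt_trichotomy t 0 with ht | rfl | ht
  · have h : (fun t : ℝ => (max 0 t) ^ (k + 1)) =ᶠ[nhds t] fun _ => 0 := by
      filter_upwards [gt_mem_nhds ht] with s hs
      simp [max_eq_left hs.le]
    rw [max_eq_left ht.le, zero_pow (by omega), mul_zero]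
    exact (hasDerivAt_const t (0 : ℝ)).congr_of_eventuallyEq h
  · rw [max_self, zero_pow (by omega), mul_zero, hasDerivAt_iff_isLittleO]
    have h : (fun x : ℝ => x ^ (k + 1)) =o[nhds 0] fun x : ℝ => x := by
      simpa using (Asymptotics.isLittleO_pow_pow (𝕜 := ℝ) (show 1 < k + 1 by omega))
    simp only [max_self, ne_eq, Nat.add_eq_zero_iff, one_ne_zero, and_false, not_false_eq_true,
      zero_pow, sub_zero, smul_zero]
    refine (Asymptotics.IsBigO.of_bound 1 (Filter.Eventually.of_forall fun x => ?_)).trans_isLittleO h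
    rw [one_mul, norm_pow, norm_pow]
    gcongr
    rw [Real.norm_eq_abs, Real.norm_eq_abs, abs_of_nonneg (le_max_left 0 x)]
    exact max_le (abs_nonneg x) (le_abs_self x)
  · have h : (fun t : ℝ => (max 0 t) ^ (k + 1)) =ᶠ[nhds t] fun t => t ^ (k + 1) := by
      filter_upwards [lt_mem_nhds ht] with s hs
      simp [max_eq_right hs.le]
    rw [max_eq_right ht.le]
    simpa using (hasDerivAt_pow (k + 1) t).congr_of_eventuallyEq h

variable {n : ℕ}

/-- The radial weight `(1 - |x|²)₊ᵏ`. -/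
noncomputable def ballWeight (k : ℕ) (x : EuclideanSpace ℝ (Fin n)) : ℝ :=
  (max 0 (1 - ‖x‖ ^ 2)) ^ k

/-- The `i`-th partial derivative. -/
noncomputable def pderiv (i : Fin n) (f : EuclideanSpace ℝ (Fin n) → ℝ)
    (x : EuclideanSpace ℝ (Fin n)) : ℝ :=
  fderiv ℝ f x (EuclideanSpace.single i 1)

/-- The Euler (radial) derivative `x · ∇f`. -/
noncomputable def eulerDeriv (f : EuclideanSpace ℝ (Fin n) → ℝ)
    (x : EuclideanSpace ℝ (Fin n)) : ℝ :=
  fderiv ℝ f x x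

lemma ballWeight_nonneg (k : ℕ) (x : EuclideanSpace ℝ (Fin n)) : 0 ≤ ballWeight k x :=
  pow_nonneg (le_max_left _ _) _

lemma max_zero_one_sub_le_one (x : EuclideanSpace ℝ (Fin n)) : max 0 (1 - ‖x‖ ^ 2) ≤ 1 :=
  max_le zero_le_one (by nlinarith [sq_nonneg ‖x‖])

lemma ballWeight_le_one (k : ℕ) (x : EuclideanSpace ℝ (Fin n)) : ballWeight k x ≤ 1 :=
  pow_le_one₀ (le_max_left _ _) (max_zero_one_sub_le_one x)

lemma ballWeight_succ_le (k : ℕ) (x : EuclideanSpace ℝ (Fin n)) :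
    ballWeight (k + 1) x ≤ ballWeight k x :=
  pow_le_pow_of_le_one (le_max_left _ _) (max_zero_one_sub_le_one x) (Nat.le_succ k)

lemma continuous_ballWeight (k : ℕ) : Continuous (ballWeight k : EuclideanSpace ℝ (Fin n) → ℝ) := by
  unfold ballWeight
  fun_prop

lemma ballWeight_eq_zero {k : ℕ} (hk : 1 ≤ k) {x : EuclideanSpace ℝ (Fin n)} (hx : 1 ≤ ‖x‖) :
    ballWeight k x = 0 := by
  have : 1 - ‖x‖ ^ 2 ≤ 0 := by nlinarith
  rw [ballWeight, max_eq_left this, zero_pow (by omega)]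

lemma hasCompactSupport_ballWeight {k : ℕ} (hk : 1 ≤ k) :
    HasCompactSupport (ballWeight k : EuclideanSpace ℝ (Fin n) → ℝ) := by
  refine HasCompactSupport.intro (isCompact_closedBall 0 1) fun x hx => ?_
  simp only [mem_closedBall, dist_zero_right, not_le] at hx
  exact ballWeight_eq_zero hk hx.le

lemma integrable_mul_ballWeight {k : ℕ} (hk : 1 ≤ k) {f : EuclideanSpace ℝ (Fin n) → ℝ}
    (hf : Continuous f) : Integrable fun x => f x * ballWeight k x :=
  (hf.mul (continuous_ballWeight k)).integrable_of_hasCompactSupport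
    (hasCompactSupport_ballWeight hk).mul_left

lemma hasFDerivAt_ballWeight {k : ℕ} (hk : 1 ≤ k) (x : EuclideanSpace ℝ (Fin n)) :
    HasFDerivAt (ballWeight (k + 1))
      (((k + 1 : ℝ) * ballWeight k x) • (-((2 : ℕ) • innerSL ℝ x))) x := by
  have h := (hasStrictFDerivAt_norm_sq x).hasFDerivAt.const_sub 1
  exact (hasDerivAt_max_zero_pow hk (1 - ‖x‖ ^ 2)).comp_hasFDerivAt x h

lemma pderiv_ballWeight {k : ℕ} (hk : 1 ≤ k) (i : Fin n) (x : EuclideanSpace ℝ (Fin n)) :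
    pderiv i (ballWeight (k + 1)) x = -(2 * (k + 1)) * (x i * ballWeight k x) := by
  rw [pderiv, (hasFDerivAt_ballWeight hk x).fderiv]
  simp [EuclideanSpace.inner_single_right]
  ring

lemma contDiff_pderiv {f : EuclideanSpace ℝ (Fin n) → ℝ} (hf : ContDiff ℝ ∞ f) (i : Fin n) :
    ContDiff ℝ ∞ (pderiv i f) :=
  (hf.fderiv_right (m := ∞) le_rfl).clm_apply contDiff_const

lemma contDiff_eulerDeriv {f : EuclideanSpace ℝ (Fin n) → ℝ} (hf : ContDiff ℝ ∞ f) :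
    ContDiff ℝ ∞ (eulerDeriv f) :=
  (hf.fderiv_right (m := ∞) le_rfl).clm_apply contDiff_id

lemma differentiable_of_smooth {f : EuclideanSpace ℝ (Fin n) → ℝ} (hf : ContDiff ℝ ∞ f) :
    Differentiable ℝ f := hf.differentiable (by simp)

lemma fderiv_eq_sum_pderiv (f : EuclideanSpace ℝ (Fin n) → ℝ) (x y : EuclideanSpace ℝ (Fin n)) :
    fderiv ℝ f x y = ∑ i, y i * pderiv i f x := by
  conv_lhs => rw [← (EuclideanSpace.basisFun (Fin n) ℝ).sum_repr y]
  simp [map_sum, pderiv]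

lemma eulerDeriv_eq_sum (f : EuclideanSpace ℝ (Fin n) → ℝ) (x : EuclideanSpace ℝ (Fin n)) :
    eulerDeriv f x = ∑ i, x i * pderiv i f x :=
  fderiv_eq_sum_pderiv f x x

lemma pderiv_comm {f : EuclideanSpace ℝ (Fin n) → ℝ} (hf : ContDiff ℝ ∞ f) (i j : Fin n)
    (x : EuclideanSpace ℝ (Fin n)) : pderiv i (pderiv j f) x = pderiv j (pderiv i f) x := by
  have hd : DifferentiableAt ℝ (fderiv ℝ f) x :=
    (hf.fderiv_right (m := ∞) le_rfl).differentiable (by simp) x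
  have hs : IsSymmSndFDerivAt ℝ f x := hf.contDiffAt.isSymmSndFDerivAt (by
    rw [minSmoothness_of_isRCLikeNormedField]; exact ENat.LEInfty.out)
  have key : ∀ a b : EuclideanSpace ℝ (Fin n),
      fderiv ℝ (fun y => fderiv ℝ f y a) x b = fderiv ℝ (fderiv ℝ f) x b a := by
    intro a b
    rw [fderiv_clm_apply hd (differentiableAt_const a)]
    simp
  unfold pderiv
  rw [key, key]
  exact hs _ _

lemma pderiv_mul {f g : EuclideanSpace ℝ (Fin n) → ℝ} (hf : ContDiff ℝ ∞ f)
    (hg : ContDiff ℝ ∞ g) (i : Fin n) (x : EuclideanSpace ℝ (Fin n)) :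
    pderiv i (fun y => f y * g y) x = f x * pderiv i g x + pderiv i f x * g x := by
  unfold pderiv
  rw [fderiv_fun_mul (differentiable_of_smooth hf x) (differentiable_of_smooth hg x)]
  simp [mul_comm]

lemma eulerDeriv_mul {f g : EuclideanSpace ℝ (Fin n) → ℝ} (hf : ContDiff ℝ ∞ f)
    (hg : ContDiff ℝ ∞ g) (x : EuclideanSpace ℝ (Fin n)) :
    eulerDeriv (fun y => f y * g y) x = f x * eulerDeriv g x + eulerDeriv f x * g x := by
  unfold eulerDeriv
  rw [fderiv_fun_mul (differentiable_of_smooth hf x) (differentiable_of_smooth hg x)]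
  simp [mul_comm]

lemma pderiv_sub {f g : EuclideanSpace ℝ (Fin n) → ℝ} (hf : ContDiff ℝ ∞ f)
    (hg : ContDiff ℝ ∞ g) (i : Fin n) (x : EuclideanSpace ℝ (Fin n)) :
    pderiv i (fun y => f y - g y) x = pderiv i f x - pderiv i g x := by
  unfold pderiv
  rw [fderiv_fun_sub (differentiable_of_smooth hf x) (differentiable_of_smooth hg x)]
  simp

lemma pderiv_add {f g : EuclideanSpace ℝ (Fin n) → ℝ} (hf : ContDiff ℝ ∞ f)
    (hg : ContDiff ℝ ∞ g) (i : Fin n) (x : EuclideanSpace ℝ (Fin n)) :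
    pderiv i (fun y => f y + g y) x = pderiv i f x + pderiv i g x := by
  unfold pderiv
  rw [fderiv_fun_add (differentiable_of_smooth hf x) (differentiable_of_smooth hg x)]
  simp

lemma pderiv_sum {ι : Type*} (s : Finset ι) {f : ι → EuclideanSpace ℝ (Fin n) → ℝ}
    (hf : ∀ j, ContDiff ℝ ∞ (f j)) (i : Fin n) (x : EuclideanSpace ℝ (Fin n)) :
    pderiv i (fun y => ∑ j ∈ s, f j y) x = ∑ j ∈ s, pderiv i (f j) x := by
  unfold pderiv
  rw [fderiv_fun_sum fun j _ => differentiable_of_smooth (hf j) x]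
  simp

lemma pderiv_coord (i j : Fin n) (x : EuclideanSpace ℝ (Fin n)) :
    pderiv i (fun y => y j) x = if i = j then 1 else 0 := by
  unfold pderiv
  rw [show (fun y : EuclideanSpace ℝ (Fin n) => y j) = EuclideanSpace.proj (𝕜 := ℝ) j from rfl,
    ContinuousLinearMap.fderiv]
  simp [eq_comm]

lemma contDiff_coord (j : Fin n) : ContDiff ℝ ∞ fun y : EuclideanSpace ℝ (Fin n) => y j :=
  (EuclideanSpace.proj (𝕜 := ℝ) j).contDiff

lemma eLap_eq (f : EuclideanSpace ℝ (Fin n) → ℝ) (x : EuclideanSpace ℝ (Fin n)) :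
    eLap f x = ∑ i, pderiv i (pderiv i f) x := rfl

/-- The divergence theorem for a vector field against the weight `(1 - |x|²)₊ᵏ`. -/
lemma integral_radial_mul_ballWeight {k : ℕ} (hk : 1 ≤ k)
    {X : Fin n → EuclideanSpace ℝ (Fin n) → ℝ} (hX : ∀ i, ContDiff ℝ ∞ (X i)) :
    2 * (k + 1) * ∫ x, (∑ i, x i * X i x) * ballWeight k x =
      ∫ x, (∑ i, pderiv i (X i) x) * ballWeight (k + 1) x := by
  have hi : ∀ i, 2 * (k + 1) * ∫ x, (x i * X i x) * ballWeight k x =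
      ∫ x, pderiv i (X i) x * ballWeight (k + 1) x := by
    intro i
    have e : (fun x => X i x * fderiv ℝ (ballWeight (k + 1)) x (EuclideanSpace.single i 1)) =
        fun x => -(2 * (k + 1)) * ((x i * X i x) * ballWeight k x) := by
      ext x
      have := pderiv_ballWeight hk i x
      rw [pderiv] at this
      rw [this]
      ring
    have h := integral_mul_fderiv_eq_neg_fderiv_mul_of_integrable (𝕜 := ℝ) (μ := volume)
      (f := X i) (g := ballWeight (k + 1)) (v := EuclideanSpace.single i 1)
      (integrable_mul_ballWeight (by omega) (contDiff_pderiv (hX i) i).continuous)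
      (by
        rw [e]
        exact (integrable_mul_ballWeight hk
          ((contDiff_coord i).continuous.mul (hX i).continuous)).const_mul _)
      (integrable_mul_ballWeight (by omega) (hX i).continuous)
      (fun x _ => differentiable_of_smooth (hX i) x)
      (fun x _ => (hasFDerivAt_ballWeight hk x).differentiableAt)
    rw [e, integral_const_mul] at h
    change _ = -∫ x, pderiv i (X i) x * ballWeight (k + 1) x at h
    linarith
  simp_rw [Finset.sum_mul]
  rw [integral_finsetSum _ fun i _ => integrable_mul_ballWeight (f := fun x => x i * X i x) hk
      ((contDiff_coord i).continuous.mul (hX i).continuous),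
    integral_finsetSum _ fun i _ => integrable_mul_ballWeight (by omega)
      (contDiff_pderiv (hX i) i).continuous, Finset.mul_sum]
  exact Finset.sum_congr rfl fun i _ => hi i

lemma eLap_eulerDeriv {f : EuclideanSpace ℝ (Fin n) → ℝ} (hf : ContDiff ℝ ∞ f)
    (x : EuclideanSpace ℝ (Fin n)) :
    eLap (eulerDeriv f) x = 2 * eLap f x + eulerDeriv (eLap f) x := by
  have h1 : ∀ i, pderiv i (eulerDeriv f) =
      fun y => pderiv i f y + ∑ j, y j * pderiv j (pderiv i f) y := by
    intro i
    ext y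
    rw [show eulerDeriv f = fun y => ∑ j, y j * pderiv j f y from funext (eulerDeriv_eq_sum f),
      pderiv_sum _ fun j => (contDiff_coord j).mul (contDiff_pderiv hf j)]
    simp_rw [pderiv_mul (contDiff_coord _) (contDiff_pderiv hf _), pderiv_coord,
      Finset.sum_add_distrib]
    simp [add_comm, pderiv_comm hf]
  have h2 : ∀ i, pderiv i (pderiv i (eulerDeriv f)) x =
      2 * pderiv i (pderiv i f) x + ∑ j, x j * pderiv j (pderiv i (pderiv i f)) x := by
    intro i
    have hs := fun j => contDiff_pderiv (contDiff_pderiv hf i) j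
    rw [h1, pderiv_add (contDiff_pderiv hf i)
      (ContDiff.sum fun j _ => (contDiff_coord j).mul (hs j)),
      pderiv_sum _ fun j => (contDiff_coord j).mul (hs j)]
    simp_rw [pderiv_mul (contDiff_coord _) (hs _), pderiv_coord, Finset.sum_add_distrib]
    simp [pderiv_comm (contDiff_pderiv hf i) i]
    ring
  simp_rw [eLap_eq, h2, Finset.sum_add_distrib, ← Finset.mul_sum, eulerDeriv_eq_sum]
  congr 1
  rw [Finset.sum_comm]
  refine Finset.sum_congr rfl fun j _ => ?_
  rw [show eLap f = fun y => ∑ i, pderiv i (pderiv i f) y from rfl,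
    pderiv_sum _ fun i => contDiff_pderiv (contDiff_pderiv hf i) i, Finset.mul_sum]

lemma mul_ballWeight_congr {k : ℕ} (hk : 1 ≤ k) {f g : EuclideanSpace ℝ (Fin n) → ℝ}
    (h : ∀ x ∈ ball (0 : EuclideanSpace ℝ (Fin n)) 1, f x = g x) (x : EuclideanSpace ℝ (Fin n)) :
    f x * ballWeight k x = g x * ballWeight k x := by
  by_cases hx : x ∈ ball (0 : EuclideanSpace ℝ (Fin n)) 1
  · rw [h x hx]
  · rw [mem_ball_zero_iff, not_lt] at hx
    rw [ballWeight_eq_zero hk hx, mul_zero, mul_zero]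

lemma integral_sq_mul_ballWeight_succ_le {k : ℕ} (hk : 1 ≤ k)
    {f : EuclideanSpace ℝ (Fin n) → ℝ} (hf : Continuous f) :
    ∫ x, (f x * f x) * ballWeight (k + 1) x ≤ ∫ x, (f x * f x) * ballWeight k x :=
  integral_mono (integrable_mul_ballWeight (by omega) (hf.mul hf))
    (integrable_mul_ballWeight hk (hf.mul hf))
    fun x => mul_le_mul_of_nonneg_left (ballWeight_succ_le k x) (mul_self_nonneg _)

section Helmholtz

variable {k : ℕ} {μ : ℝ} {f : EuclideanSpace ℝ (Fin n) → ℝ}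

lemma neg_integral_sq_le_integral_mul_eulerDeriv (hk : 1 ≤ k) (hμ : 0 ≤ μ)
    (hf : ContDiff ℝ ∞ f)
    (hΔ : ∀ x ∈ ball (0 : EuclideanSpace ℝ (Fin n)) 1, eLap f x = -μ * f x) :
    -(μ * ∫ x, (f x * f x) * ballWeight k x) ≤
      2 * (k + 1) * ∫ x, (f x * eulerDeriv f x) * ballWeight k x := by
  have h := integral_radial_mul_ballWeight hk (X := fun i x => f x * pderiv i f x)
    fun i => hf.mul (contDiff_pderiv hf i)
  have e : ∀ x, (∑ i, x i * (f x * pderiv i f x)) = f x * eulerDeriv f x := by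
    intro x
    rw [eulerDeriv_eq_sum, Finset.mul_sum]
    exact Finset.sum_congr rfl fun i _ => by ring
  simp_rw [e] at h
  rw [h]
  have h1 : -(μ * ∫ x, (f x * f x) * ballWeight k x) ≤
      -(μ * ∫ x, (f x * f x) * ballWeight (k + 1) x) :=
    neg_le_neg (mul_le_mul_of_nonneg_left
      (integral_sq_mul_ballWeight_succ_le hk hf.continuous) hμ)
  refine h1.trans ?_
  rw [← integral_const_mul, ← integral_neg]
  refine integral_mono ((integrable_mul_ballWeight (by omega)
    (hf.continuous.mul hf.continuous)).const_mul _).neg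
    (integrable_mul_ballWeight (by omega) ?_) fun x => ?_
  · exact continuous_finsetSum _ fun i _ =>
      (contDiff_pderiv (hf.mul (contDiff_pderiv hf i)) i).continuous
  · simp_rw [pderiv_mul hf (contDiff_pderiv hf _), Finset.sum_add_distrib, ← Finset.mul_sum,
      ← eLap_eq]
    have h2 := mul_ballWeight_congr (k := k + 1) (by omega) hΔ x
    have h3 : 0 ≤ (∑ i, pderiv i f x * pderiv i f x) * ballWeight (k + 1) x :=
      mul_nonneg (Finset.sum_nonneg fun i _ => mul_self_nonneg _) (ballWeight_nonneg _ _)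
    calc -(μ * (f x * f x * ballWeight (k + 1) x))
        = f x * (-μ * f x * ballWeight (k + 1) x) := by ring
      _ = f x * (eLap f x * ballWeight (k + 1) x) := by rw [h2]
      _ ≤ _ := by linarith

lemma integral_eulerDeriv_antisymm (hk : 1 ≤ k) (hf : ContDiff ℝ ∞ f)
    (hΔ : ∀ x ∈ ball (0 : EuclideanSpace ℝ (Fin n)) 1, eLap f x = -μ * f x) :
    2 * (k + 1) * ∫ x, (f x * eulerDeriv (eulerDeriv f) x - eulerDeriv f x * eulerDeriv f x) *
      ballWeight k x = -(2 * μ) * ∫ x, (f x * f x) * ballWeight (k + 1) x := by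
  have hE := contDiff_eulerDeriv hf
  have h := integral_radial_mul_ballWeight hk
    (X := fun i x => f x * pderiv i (eulerDeriv f) x - eulerDeriv f x * pderiv i f x)
    fun i => (hf.mul (contDiff_pderiv hE i)).sub (hE.mul (contDiff_pderiv hf i))
  have e : ∀ x, (∑ i, x i * (f x * pderiv i (eulerDeriv f) x - eulerDeriv f x * pderiv i f x)) =
      f x * eulerDeriv (eulerDeriv f) x - eulerDeriv f x * eulerDeriv f x := by
    intro x
    rw [eulerDeriv_eq_sum (eulerDeriv f) x]
    conv_rhs => rw [eulerDeriv_eq_sum f x]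
    rw [Finset.mul_sum, Finset.mul_sum, ← Finset.sum_sub_distrib]
    refine Finset.sum_congr rfl fun i _ => ?_
    rw [← eulerDeriv_eq_sum f x]
    ring
  simp_rw [e] at h
  rw [h, ← integral_const_mul]
  congr 1
  ext x
  rw [← mul_assoc]
  refine mul_ballWeight_congr (k := k + 1) (by omega) (f := fun x => ∑ i, pderiv i (fun x =>
    f x * pderiv i (eulerDeriv f) x - eulerDeriv f x * pderiv i f x) x)
    (g := fun x => -(2 * μ) * (f x * f x)) (fun x hx => ?_) x
  have hd : eulerDeriv (eLap f) x = -μ * eulerDeriv f x := by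
    have : eLap f =ᶠ[nhds x] fun y => -μ * f y := by
      filter_upwards [isOpen_ball.mem_nhds hx] with y hy using hΔ y hy
    rw [eulerDeriv, this.fderiv_eq, fderiv_const_mul (differentiable_of_smooth hf x)]
    simp [eulerDeriv]
  have hs : ∀ i, pderiv i (fun x => f x * pderiv i (eulerDeriv f) x -
      eulerDeriv f x * pderiv i f x) x = f x * pderiv i (pderiv i (eulerDeriv f)) x -
        eulerDeriv f x * pderiv i (pderiv i f) x := by
    intro i
    rw [pderiv_sub (hf.mul (contDiff_pderiv hE i)) (hE.mul (contDiff_pderiv hf i)),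
      pderiv_mul hf (contDiff_pderiv hE i), pderiv_mul hE (contDiff_pderiv hf i)]
    ring
  simp_rw [hs]
  rw [Finset.sum_sub_distrib, ← Finset.mul_sum, ← Finset.mul_sum, ← eLap_eq, ← eLap_eq,
    eLap_eulerDeriv hf, hd, hΔ x hx]
  ring

end Helmholtz

lemma integral_mul_ballWeight_sq_le {k : ℕ} (hk : 1 ≤ k) {f g : EuclideanSpace ℝ (Fin n) → ℝ}
    (hf : Continuous f) (hg : Continuous g) :
    (∫ x, (f x * g x) * ballWeight k x) ^ 2 ≤
      (∫ x, (f x * f x) * ballWeight k x) * ∫ x, (g x * g x) * ballWeight k x := by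
  have key : ∀ t : ℝ, 0 ≤ (∫ x, (f x * f x) * ballWeight k x) * (t * t) +
      (2 * ∫ x, (f x * g x) * ballWeight k x) * t + ∫ x, (g x * g x) * ballWeight k x := by
    intro t
    have h : 0 ≤ ∫ x, ((t * f x + g x) * (t * f x + g x)) * ballWeight k x :=
      integral_nonneg fun x => mul_nonneg (mul_self_nonneg _) (ballWeight_nonneg _ _)
    have e : (fun x => ((t * f x + g x) * (t * f x + g x)) * ballWeight k x) = fun x =>
        ((t * t) * ((f x * f x) * ballWeight k x) + (2 * t) * ((f x * g x) * ballWeight k x)) +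
          (g x * g x) * ballWeight k x := by
      ext x; ring
    have i1 := (integrable_mul_ballWeight hk (f := fun x => f x * f x) (hf.mul hf)).const_mul (t * t)
    have i2 := (integrable_mul_ballWeight hk (f := fun x => f x * g x) (hf.mul hg)).const_mul (2 * t)
    have i3 := integrable_mul_ballWeight hk (f := fun x => g x * g x) (hg.mul hg)
    rw [e, integral_add (f := fun x => (t * t) * ((f x * f x) * ballWeight k x) +
      (2 * t) * ((f x * g x) * ballWeight k x)) (i1.add i2) i3,
      integral_add i1 i2, integral_const_mul, integral_const_mul] at h
    linarith
  have := discrim_le_zero key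
  rw [discrim] at this
  linarith

/-- The weighted integral of the dilation `x ↦ h (eˢ x)`. -/
noncomputable def dilatedMean (k : ℕ) (h : EuclideanSpace ℝ (Fin n) → ℝ) (s : ℝ) : ℝ :=
  ∫ x, h (Real.exp s • x) * ballWeight k x

lemma hasDerivAt_dilation {h : EuclideanSpace ℝ (Fin n) → ℝ} (hh : ContDiff ℝ ∞ h)
    (x : EuclideanSpace ℝ (Fin n)) (s : ℝ) :
    HasDerivAt (fun s => h (Real.exp s • x)) (eulerDeriv h (Real.exp s • x)) s :=
  ((differentiable_of_smooth hh _).hasFDerivAt).comp_hasDerivAt s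
    ((Real.hasDerivAt_exp s).smul_const x)

lemma hasDerivAt_dilatedMean {k : ℕ} (hk : 1 ≤ k) {h : EuclideanSpace ℝ (Fin n) → ℝ}
    (hh : ContDiff ℝ ∞ h) (s : ℝ) :
    HasDerivAt (dilatedMean k h) (dilatedMean k (eulerDeriv h) s) s := by
  have hE := (contDiff_eulerDeriv hh).continuous
  have hc : ∀ (s : ℝ) {g : EuclideanSpace ℝ (Fin n) → ℝ}, Continuous g →
      Integrable fun x => g (Real.exp s • x) * ballWeight k x := fun s g hg =>
    integrable_mul_ballWeight hk (hg.comp (continuous_const_smul _))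
  obtain ⟨B, hB⟩ := (isCompact_closedBall (0 : EuclideanSpace ℝ (Fin n))
    (Real.exp (s + 1))).exists_bound_of_continuousOn hE.continuousOn
  refine (hasDerivAt_integral_of_dominated_loc_of_deriv_le (ball_mem_nhds s one_pos)
    (bound := fun x => B * ballWeight k x)
    (F' := fun s x => eulerDeriv h (Real.exp s • x) * ballWeight k x)
    (Filter.Eventually.of_forall fun t => (hc t hh.continuous).aestronglyMeasurable)
    (hc s hh.continuous) (hc s hE).aestronglyMeasurable
    (Filter.Eventually.of_forall fun x t ht => ?_)
    (integrable_mul_ballWeight hk continuous_const)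
    (Filter.Eventually.of_forall fun x t _ => (hasDerivAt_dilation hh x t).mul_const _)).2
  rw [norm_mul, Real.norm_of_nonneg (ballWeight_nonneg k x)]
  by_cases hx : 1 ≤ ‖x‖
  · simp [ballWeight_eq_zero hk hx]
  · refine mul_le_mul_of_nonneg_right (hB _ ?_) (ballWeight_nonneg _ _)
    rw [mem_closedBall_zero_iff, norm_smul, Real.norm_of_nonneg (Real.exp_pos t).le]
    rw [Real.ball_eq_Ioo] at ht
    have : Real.exp t ≤ Real.exp (s + 1) := Real.exp_le_exp.2 ht.2.le
    nlinarith [Real.exp_pos t, norm_nonneg x]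

lemma contDiff_dilation {h : EuclideanSpace ℝ (Fin n) → ℝ} (hh : ContDiff ℝ ∞ h) (c : ℝ) :
    ContDiff ℝ ∞ fun x => h (c • x) :=
  hh.comp (contDiff_const_smul c)

lemma fderiv_dilation {h : EuclideanSpace ℝ (Fin n) → ℝ} (hh : ContDiff ℝ ∞ h) (c : ℝ)
    (x y : EuclideanSpace ℝ (Fin n)) :
    fderiv ℝ (fun x => h (c • x)) x y = c * fderiv ℝ h (c • x) y := by
  have h1 : HasFDerivAt (fun x : EuclideanSpace ℝ (Fin n) => c • x)
      (c • ContinuousLinearMap.id ℝ (EuclideanSpace ℝ (Fin n))) x :=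
    (hasFDerivAt_id x).const_smul c
  have h2 : HasFDerivAt (fun x => h (c • x)) _ x :=
    ((differentiable_of_smooth hh (c • x)).hasFDerivAt).comp x h1
  rw [h2.fderiv]
  simp

lemma pderiv_dilation {h : EuclideanSpace ℝ (Fin n) → ℝ} (hh : ContDiff ℝ ∞ h) (c : ℝ)
    (i : Fin n) (x : EuclideanSpace ℝ (Fin n)) :
    pderiv i (fun x => h (c • x)) x = c * pderiv i h (c • x) :=
  fderiv_dilation hh c x _

lemma eulerDeriv_dilation {h : EuclideanSpace ℝ (Fin n) → ℝ} (hh : ContDiff ℝ ∞ h) (c : ℝ) :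
    eulerDeriv (fun x => h (c • x)) = fun x => eulerDeriv h (c • x) := by
  ext x
  rw [eulerDeriv, fderiv_dilation hh, eulerDeriv, map_smul, smul_eq_mul]

lemma eLap_dilation {h : EuclideanSpace ℝ (Fin n) → ℝ} (hh : ContDiff ℝ ∞ h) (c : ℝ)
    (x : EuclideanSpace ℝ (Fin n)) :
    eLap (fun x => h (c • x)) x = c ^ 2 * eLap h (c • x) := by
  simp_rw [eLap_eq, Finset.mul_sum]
  refine Finset.sum_congr rfl fun i _ => ?_
  have e : pderiv i (fun x => h (c • x)) = fun x => c * pderiv i h (c • x) :=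
    funext (pderiv_dilation hh c i)
  have hs := contDiff_dilation (contDiff_pderiv hh i) c
  rw [e, pderiv_mul contDiff_const hs, pderiv_dilation (contDiff_pderiv hh i)]
  simp [pderiv]
  ring

lemma dilatedMean_sq_ineqs {k : ℕ} (hk : 1 ≤ k) {lam P s : ℝ} (hlam : 0 ≤ lam)
    {v : EuclideanSpace ℝ (Fin n) → ℝ} (hv : ContDiff ℝ ∞ v)
    (hΔ : ∀ x ∈ ball (0 : EuclideanSpace ℝ (Fin n)) P, eLap v x = -lam * v x)
    (hs : Real.exp s ≤ P) :
    let G := dilatedMean k (fun x => v x * v x) s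
    let G₁ := dilatedMean k (eulerDeriv fun x => v x * v x) s
    let G₂ := dilatedMean k (eulerDeriv (eulerDeriv fun x => v x * v x)) s
    let c := lam / (2 * (k + 1))
    0 ≤ G ∧ -(2 * c * Real.exp (2 * s)) * G ≤ G₁ ∧
      0 ≤ G₂ + 4 * c * Real.exp (2 * s) * G ∧
      G₁ ^ 2 ≤ (G₂ + 4 * c * Real.exp (2 * s) * G) * G := by
  intro G G₁ G₂ c
  set f : EuclideanSpace ℝ (Fin n) → ℝ := fun x => v (Real.exp s • x) with hf_def
  have hf : ContDiff ℝ ∞ f := contDiff_dilation hv _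
  have hE := contDiff_eulerDeriv hf
  have hEE := contDiff_eulerDeriv hE
  have hEv := contDiff_eulerDeriv hv
  have e1 : eulerDeriv f = fun x => eulerDeriv v (Real.exp s • x) := eulerDeriv_dilation hv _
  have e2 : eulerDeriv (eulerDeriv f) = fun x => eulerDeriv (eulerDeriv v) (Real.exp s • x) := by
    rw [e1, eulerDeriv_dilation hEv]
  set μ := lam * Real.exp (2 * s) with hμ_def
  have hμ : 0 ≤ μ := mul_nonneg hlam (Real.exp_pos _).le
  have hfΔ : ∀ x ∈ ball (0 : EuclideanSpace ℝ (Fin n)) 1, eLap f x = -μ * f x := by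
    intro x hx
    rw [mem_ball_zero_iff] at hx
    have hb : Real.exp s • x ∈ ball (0 : EuclideanSpace ℝ (Fin n)) P := by
      rw [mem_ball_zero_iff, norm_smul, Real.norm_of_nonneg (Real.exp_pos s).le]
      nlinarith [Real.exp_pos s]
    rw [hf_def, eLap_dilation hv, hΔ _ hb, hμ_def, two_mul s, Real.exp_add]
    ring
  have hv1 : eulerDeriv (fun x => v x * v x) = fun x => v x * eulerDeriv v x + eulerDeriv v x * v x :=
    funext (eulerDeriv_mul hv hv)
  have hv1' : eulerDeriv (fun x => v x * v x) = fun x => (2 * v x) * eulerDeriv v x := by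
    rw [hv1]; ext x; ring
  have hv2 : ∀ x, eulerDeriv (eulerDeriv fun x => v x * v x) x =
      2 * (v x * eulerDeriv (eulerDeriv v) x) + 2 * (eulerDeriv v x * eulerDeriv v x) := by
    intro x
    have h2 : eulerDeriv (fun x => 2 * v x) x = 2 * eulerDeriv v x := by
      rw [eulerDeriv_mul contDiff_const hv]
      simp [eulerDeriv]
    rw [hv1', eulerDeriv_mul (contDiff_const.mul hv) hEv, h2]
    ring
  set a := ∫ x, (f x * f x) * ballWeight k x
  set b := ∫ x, (f x * eulerDeriv f x) * ballWeight k x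
  set d := ∫ x, (eulerDeriv f x * eulerDeriv f x) * ballWeight k x
  set g := ∫ x, (f x * f x) * ballWeight (k + 1) x
  have hG : G = a := rfl
  have hG₁ : G₁ = 2 * b := by
    simp only [G₁, b, dilatedMean, hv1', e1]
    rw [← integral_const_mul]
    congr 1
    ext x
    simp only [f]
    ring
  have i1 := (integrable_mul_ballWeight hk (f := fun x => eulerDeriv f x * eulerDeriv f x)
    (hE.continuous.mul hE.continuous))
  have i2 := (integrable_mul_ballWeight hk (f := fun x => f x * eulerDeriv (eulerDeriv f) x -
    eulerDeriv f x * eulerDeriv f x)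
    ((hf.continuous.mul hEE.continuous).sub (hE.continuous.mul hE.continuous)))
  have hG₂ : G₂ = 4 * d + 2 * ∫ x, (f x * eulerDeriv (eulerDeriv f) x -
      eulerDeriv f x * eulerDeriv f x) * ballWeight k x := by
    simp only [G₂, d, dilatedMean]
    rw [← integral_const_mul, ← integral_const_mul, ← integral_add (i1.const_mul _)
      (i2.const_mul _)]
    congr 1
    ext x
    rw [hv2, e2, e1, hf_def]
    ring
  have hk0 : (0 : ℝ) < k + 1 := by positivity
  have ha : 0 ≤ a := integral_nonneg fun x => mul_nonneg (mul_self_nonneg _) (ballWeight_nonneg _ _)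
  have hd : 0 ≤ d := integral_nonneg fun x => mul_nonneg (mul_self_nonneg _) (ballWeight_nonneg _ _)
  have hanti := integral_eulerDeriv_antisymm hk hf hfΔ
  have hlow := neg_integral_sq_le_integral_mul_eulerDeriv hk hμ hf hfΔ
  have hga : g ≤ a := integral_sq_mul_ballWeight_succ_le hk hf.continuous
  have hcs : b ^ 2 ≤ a * d := integral_mul_ballWeight_sq_le hk hf.continuous hE.continuous
  have hc : 2 * (k + 1) * (c * Real.exp (2 * s)) = μ := by
    simp only [c, hμ_def]
    field_simp
  have hce : 0 ≤ c * Real.exp (2 * s) := by positivity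
  have hG₂' : G₂ = 4 * d - 4 * (c * Real.exp (2 * s)) * g := by
    rw [hG₂]
    have : ∀ z : ℝ, 2 * (k + 1) * z = -(2 * μ) * g → z = -(2 * (c * Real.exp (2 * s)) * g) := by
      intro z hz
      rw [← hc] at hz
      have : 2 * (k + 1 : ℝ) ≠ 0 := by positivity
      apply mul_left_cancel₀ this
      linarith
    rw [this _ hanti]
    ring
  have hD : 4 * d ≤ G₂ + 4 * c * Real.exp (2 * s) * G := by
    rw [hG₂', hG]
    nlinarith [mul_le_mul_of_nonneg_left hga hce]
  refine ⟨ha, ?_, by linarith, ?_⟩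
  · rw [hG, hG₁]
    rw [← hc] at hlow
    have h2 : 2 * (k + 1 : ℝ) * (-(c * Real.exp (2 * s)) * a) ≤ 2 * (k + 1) * b := by linarith
    have := le_of_mul_le_mul_left h2 (by positivity)
    linarith
  · calc G₁ ^ 2 = 4 * b ^ 2 := by rw [hG₁]; ring
      _ ≤ (4 * d) * G := by rw [hG]; linarith
      _ ≤ _ := mul_le_mul_of_nonneg_right hD ha

section LogConvexity

variable {c S : ℝ} {G G₁ G₂ : ℝ → ℝ}

lemma monotoneOn_Iio_of_hasDerivAt {F F' : ℝ → ℝ} (hF : ∀ s < S, HasDerivAt F (F' s) s)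
    (h : ∀ s < S, 0 ≤ F' s) : MonotoneOn F (Set.Iio S) := by
  refine monotoneOn_of_deriv_nonneg (convex_Iio S)
    (fun s hs => (hF s hs).continuousAt.continuousWithinAt)
    (fun s hs => ?_) fun s hs => ?_
  · rw [interior_Iio] at hs
    exact (hF s hs).differentiableAt.differentiableWithinAt
  · rw [interior_Iio] at hs
    rw [(hF s hs).deriv]
    exact h s hs

lemma hasDerivAt_mul_exp_two_mul (a s : ℝ) :
    HasDerivAt (fun s => a * Real.exp (2 * s)) (2 * a * Real.exp (2 * s)) s := by
  have h := (((hasDerivAt_id s).const_mul 2).exp).const_mul a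
  exact h.congr_deriv (by simp only [id]; ring)

lemma le_exp_mul_of_deriv_ge (hc : 0 ≤ c) (hG : ∀ s < S, HasDerivAt G (G₁ s) s)
    (h0 : ∀ s < S, 0 ≤ G s)
    (h1 : ∀ s < S, -(2 * c * Real.exp (2 * s)) * G s ≤ G₁ s)
    {s t : ℝ} (hst : s ≤ t) (ht : t < S) : G s ≤ Real.exp (c * Real.exp (2 * t)) * G t := by
  have hm : MonotoneOn (fun s => Real.exp (c * Real.exp (2 * s)) * G s) (Set.Iio S) := by
    refine monotoneOn_Iio_of_hasDerivAt
      (fun s hs => ((hasDerivAt_mul_exp_two_mul c s).exp).mul (hG s hs)) fun s hs => ?_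
    have := h1 s hs
    calc (0 : ℝ) ≤ Real.exp (c * Real.exp (2 * s)) * (2 * c * Real.exp (2 * s) * G s + G₁ s) :=
          mul_nonneg (Real.exp_pos _).le (by linarith)
      _ = _ := by ring
  calc G s ≤ Real.exp (c * Real.exp (2 * s)) * G s :=
        le_mul_of_one_le_left (h0 s (hst.trans_lt ht)) (Real.one_le_exp (by positivity))
    _ ≤ _ := hm (hst.trans_lt ht) ht hst

lemma mul_le_exp_mul_mul_of_pos (hc : 0 ≤ c) (hG : ∀ s < S, HasDerivAt G (G₁ s) s)
    (hG₁ : ∀ s < S, HasDerivAt G₁ (G₂ s) s) (h0 : ∀ s < S, 0 < G s)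
    (h1 : ∀ s < S, G₁ s ^ 2 ≤ (G₂ s + 4 * c * Real.exp (2 * s) * G s) * G s)
    {s t h : ℝ} (hst : s ≤ t) (hh : 0 ≤ h) (ht : t + h < S) :
    G (s + h) * G t ≤ Real.exp (c * Real.exp (2 * (t + h))) * (G s * G (t + h)) := by
  have hm : MonotoneOn (fun s => G₁ s / G s + 2 * c * Real.exp (2 * s)) (Set.Iio S) := by
    refine monotoneOn_Iio_of_hasDerivAt
      (fun s hs => ((hG₁ s hs).div (hG s hs) (h0 s hs).ne').add
        (hasDerivAt_mul_exp_two_mul (2 * c) s)) fun s hs => ?_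
    have := h1 s hs
    have hp := h0 s hs
    have e : (G₂ s * G s - G₁ s * G₁ s) / G s ^ 2 + 2 * (2 * c) * Real.exp (2 * s) =
        ((G₂ s + 4 * c * Real.exp (2 * s) * G s) * G s - G₁ s ^ 2) / G s ^ 2 := by
      field_simp
      ring
    rw [e]
    exact div_nonneg (by linarith) (sq_nonneg _)
  have hL : ∀ s < S, HasDerivAt (fun s => Real.log (G s) + c * Real.exp (2 * s))
      (G₁ s / G s + 2 * c * Real.exp (2 * s)) s := fun s hs =>
    ((hG s hs).log (h0 s hs).ne').add (hasDerivAt_mul_exp_two_mul c s)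
  have hm2 : MonotoneOn (fun s => (Real.log (G (s + h)) + c * Real.exp (2 * (s + h))) -
      (Real.log (G s) + c * Real.exp (2 * s))) (Set.Iio (S - h)) := by
    refine monotoneOn_Iio_of_hasDerivAt (F' := fun s =>
      (G₁ (s + h) / G (s + h) + 2 * c * Real.exp (2 * (s + h))) -
      (G₁ s / G s + 2 * c * Real.exp (2 * s)))
      (fun s hs => ((hL (s + h) (by linarith)).comp_add_const s h).sub
        (hL s (by linarith))) fun s hs => ?_
    have := hm (show s < S by linarith) (show s + h < S by linarith) (by linarith)
    simp only at this
    linarith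
  have key := hm2 (show s < S - h by linarith) (show t < S - h by linarith) hst
  simp only at key
  have e1 : c * Real.exp (2 * s) ≤ c * Real.exp (2 * (s + h)) := by gcongr; linarith
  have e2 : 0 ≤ c * Real.exp (2 * t) := by positivity
  have p1 := h0 (s + h) (by linarith)
  have p2 := h0 t (by linarith)
  have p3 := h0 s (by linarith)
  have p4 := h0 (t + h) ht
  rw [← Real.log_le_log_iff (by positivity) (by positivity),
    Real.log_mul p1.ne' p2.ne', Real.log_mul (Real.exp_pos _).ne' (by positivity), Real.log_exp,
    Real.log_mul p3.ne' p4.ne']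
  linarith

lemma mul_le_exp_mul_mul (hc : 0 ≤ c) (hG : ∀ s < S, HasDerivAt G (G₁ s) s)
    (hG₁ : ∀ s < S, HasDerivAt G₁ (G₂ s) s) (h0 : ∀ s < S, 0 ≤ G s)
    (h1 : ∀ s < S, 0 ≤ G₂ s + 4 * c * Real.exp (2 * s) * G s)
    (h2 : ∀ s < S, G₁ s ^ 2 ≤ (G₂ s + 4 * c * Real.exp (2 * s) * G s) * G s)
    {s t h : ℝ} (hst : s ≤ t) (hh : 0 ≤ h) (ht : t + h < S) :
    G (s + h) * G t ≤ Real.exp (c * Real.exp (2 * (t + h))) * (G s * G (t + h)) := by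
  have key : ∀ ε > 0, (G (s + h) + ε) * (G t + ε) ≤
      Real.exp (c * Real.exp (2 * (t + h))) * ((G s + ε) * (G (t + h) + ε)) := by
    intro ε hε
    refine mul_le_exp_mul_mul_of_pos (G := fun s => G s + ε) hc
      (fun s hs => (hG s hs).add_const ε) hG₁
      (fun s hs => by linarith [h0 s hs]) (fun s hs => ?_) hst hh ht
    have a1 := h0 s hs
    have a2 := h1 s hs
    have a3 : 0 ≤ 4 * c * Real.exp (2 * s) * ε := by positivity
    refine (h2 s hs).trans (mul_le_mul ?_ ?_ a1 ?_) <;> linarith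
  have hcl : ∀ᶠ ε in nhdsWithin (0 : ℝ) (Set.Ioi 0), (G (s + h) + ε) * (G t + ε) ≤
      Real.exp (c * Real.exp (2 * (t + h))) * ((G s + ε) * (G (t + h) + ε)) :=
    eventually_mem_nhdsWithin.mono key
  have l1 : Filter.Tendsto (fun ε => (G (s + h) + ε) * (G t + ε)) (nhdsWithin (0 : ℝ) (Set.Ioi 0))
      (nhds ((G (s + h) + 0) * (G t + 0))) :=
    Filter.Tendsto.mono_left (Continuous.tendsto (by fun_prop) 0) nhdsWithin_le_nhds
  have l2 : Filter.Tendsto (fun ε => Real.exp (c * Real.exp (2 * (t + h))) *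
      ((G s + ε) * (G (t + h) + ε))) (nhdsWithin (0 : ℝ) (Set.Ioi 0))
      (nhds (Real.exp (c * Real.exp (2 * (t + h))) * ((G s + 0) * (G (t + h) + 0)))) :=
    Filter.Tendsto.mono_left (Continuous.tendsto (by fun_prop) 0) nhdsWithin_le_nhds
  simpa using le_of_tendsto_of_tendsto l1 l2 hcl

end LogConvexity

lemma dilatedMean_le_setIntegral_ball {k : ℕ} (hk : 1 ≤ k) {N : EuclideanSpace ℝ (Fin n) → ℝ}
    (hN : Continuous N) (h0 : ∀ x, 0 ≤ N x) {r : ℝ} (hr : 0 < r) :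
    dilatedMean k N (Real.log r) ≤
      (r ^ n)⁻¹ * ∫ x in ball (0 : EuclideanSpace ℝ (Fin n)) r, N x := by
  have hc : Continuous fun x => N (r • x) := hN.comp (continuous_const_smul r)
  have h := Measure.setIntegral_comp_smul_of_pos volume N
    (ball (0 : EuclideanSpace ℝ (Fin n)) 1) hr
  rw [_root_.smul_ball hr.ne', smul_zero, Real.norm_of_nonneg hr.le, mul_one,
    finrank_euclideanSpace_fin, smul_eq_mul] at h
  rw [← h, dilatedMean, Real.exp_log hr,
    ← setIntegral_eq_integral_of_forall_compl_eq_zero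
      (s := ball (0 : EuclideanSpace ℝ (Fin n)) 1) fun x hx => by
        rw [mem_ball_zero_iff, not_lt] at hx
        rw [ballWeight_eq_zero hk hx, mul_zero]]
  have hi : IntegrableOn (fun x => N (r • x)) (closedBall 0 1) :=
    hc.continuousOn.integrableOn_compact (isCompact_closedBall 0 1)
  refine integral_mono (integrable_mul_ballWeight hk hc).integrableOn
    (hi.mono_set ball_subset_closedBall) fun x => ?_
  exact mul_le_of_le_one_right (h0 _) (ballWeight_le_one k x)

lemma setIntegral_le_dilatedMean {k : ℕ} (hk : 1 ≤ k) {N : EuclideanSpace ℝ (Fin n) → ℝ}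
    (hN : Continuous N) (h0 : ∀ x, 0 ≤ N x) {r a : ℝ} (hr : 0 < r) (ha : 0 ≤ a) (ha1 : a ≤ 1)
    {s : Set (EuclideanSpace ℝ (Fin n))} (hs : s ⊆ closedBall 0 (r * a)) :
    (1 - a ^ 2) ^ k * ((r ^ n)⁻¹ * ∫ x in s, N x) ≤ dilatedMean k N (Real.log r) := by
  have hc : Continuous fun x => N (r • x) := hN.comp (continuous_const_smul r)
  have h := Measure.setIntegral_comp_smul_of_pos volume N
    (closedBall (0 : EuclideanSpace ℝ (Fin n)) a) hr
  rw [_root_.smul_closedBall _ _ ha, smul_zero, Real.norm_of_nonneg hr.le,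
    finrank_euclideanSpace_fin, smul_eq_mul] at h
  have ha2 : 0 ≤ 1 - a ^ 2 := by nlinarith
  have i1 : IntegrableOn (fun x => N (r • x)) (closedBall 0 a) :=
    hc.continuousOn.integrableOn_compact (isCompact_closedBall 0 a)
  have i2 : IntegrableOn N (closedBall 0 (r * a)) :=
    hN.continuousOn.integrableOn_compact (isCompact_closedBall 0 _)
  calc (1 - a ^ 2) ^ k * ((r ^ n)⁻¹ * ∫ x in s, N x)
      ≤ (1 - a ^ 2) ^ k * ((r ^ n)⁻¹ * ∫ x in closedBall 0 (r * a), N x) := by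
        have hle : ∫ x in s, N x ≤ ∫ x in closedBall 0 (r * a), N x :=
          setIntegral_mono_set i2 (Filter.Eventually.of_forall h0) (Filter.Eventually.of_forall hs)
        gcongr
    _ = ∫ x in closedBall 0 a, (1 - a ^ 2) ^ k * N (r • x) := by
        rw [← h, integral_const_mul]
    _ ≤ ∫ x in closedBall 0 a, N (r • x) * ballWeight k x := by
        refine setIntegral_mono_on (i1.const_mul _) (integrable_mul_ballWeight hk hc).integrableOn
          measurableSet_closedBall fun x hx => ?_
        rw [mem_closedBall_zero_iff] at hx
        rw [mul_comm]
        refine mul_le_mul_of_nonneg_left (pow_le_pow_left₀ ha2 ?_ k) (h0 _)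
        exact le_max_of_le_right (by nlinarith [norm_nonneg x])
    _ ≤ ∫ x, N (r • x) * ballWeight k x :=
        setIntegral_le_integral (integrable_mul_ballWeight hk hc)
          (Filter.Eventually.of_forall fun x => mul_nonneg (h0 _) (ballWeight_nonneg _ _))
    _ = dilatedMean k N (Real.log r) := by rw [dilatedMean, Real.exp_log hr]

lemma dilatedMean_sum {k : ℕ} (hk : 1 ≤ k) {ι : Type*} [Fintype ι]
    {g : ι → EuclideanSpace ℝ (Fin n) → ℝ} (hg : ∀ i, Continuous (g i)) (s : ℝ) :
    dilatedMean k (fun x => ∑ i, g i x) s = ∑ i, dilatedMean k (g i) s := by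
  simp_rw [dilatedMean, Finset.sum_mul]
  exact integral_finsetSum _ fun i _ =>
    integrable_mul_ballWeight hk ((hg i).comp (continuous_const_smul _))

/-- Growth and logarithmic convexity of the dilated means of a vector-valued solution of the
Helmholtz equation. -/
lemma dilatedMean_helmholtz {k : ℕ} (hk : 1 ≤ k) {lam P : ℝ} (hlam : 0 ≤ lam) (hP : 0 < P)
    {ι : Type*} [Fintype ι] {v : ι → EuclideanSpace ℝ (Fin n) → ℝ} (hv : ∀ i, ContDiff ℝ ∞ (v i))
    (hΔ : ∀ i, ∀ x ∈ ball (0 : EuclideanSpace ℝ (Fin n)) P, eLap (v i) x = -lam * v i x) :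
    let G := dilatedMean k fun x => ∑ i, v i x * v i x
    let c := lam / (2 * (k + 1))
    (∀ s t, s ≤ t → t < Real.log P → G s ≤ Real.exp (c * Real.exp (2 * t)) * G t) ∧
      ∀ s t h, s ≤ t → 0 ≤ h → t + h < Real.log P →
        G (s + h) * G t ≤ Real.exp (c * Real.exp (2 * (t + h))) * (G s * G (t + h)) := by
  intro G c
  have hvv : ∀ i, ContDiff ℝ ∞ fun x => v i x * v i x := fun i => (hv i).mul (hv i)
  have hG : G = fun s => ∑ i, dilatedMean k (fun x => v i x * v i x) s :=
    funext fun s => dilatedMean_sum hk (fun i => (hvv i).continuous) s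
  set G₁ := fun s => ∑ i, dilatedMean k (eulerDeriv fun x => v i x * v i x) s
  set G₂ := fun s => ∑ i, dilatedMean k (eulerDeriv (eulerDeriv fun x => v i x * v i x)) s
  have hc : 0 ≤ c := by positivity
  have hd1 : ∀ s < Real.log P, HasDerivAt G (G₁ s) s := fun s _ => by
    rw [hG]
    exact HasDerivAt.fun_sum fun i _ => hasDerivAt_dilatedMean hk (hvv i) s
  have hd2 : ∀ s < Real.log P, HasDerivAt G₁ (G₂ s) s := fun s _ =>
    HasDerivAt.fun_sum fun i _ => hasDerivAt_dilatedMean hk (contDiff_eulerDeriv (hvv i)) s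
  have hi := fun s (hs : s < Real.log P) i => dilatedMean_sq_ineqs hk hlam (hv i) (hΔ i)
    ((Real.lt_log_iff_exp_lt hP).1 hs).le
  simp only at hi
  have hD : ∀ s, G₂ s + 4 * c * Real.exp (2 * s) * G s =
      ∑ i, (dilatedMean k (eulerDeriv (eulerDeriv fun x => v i x * v i x)) s +
        4 * c * Real.exp (2 * s) * dilatedMean k (fun x => v i x * v i x) s) := by
    intro s
    rw [Finset.sum_add_distrib, ← Finset.mul_sum, hG]
  have h0 : ∀ s < Real.log P, 0 ≤ G s := fun s hs => by
    rw [hG]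
    exact Finset.sum_nonneg fun i _ => (hi s hs i).1
  have h1 : ∀ s < Real.log P, -(2 * c * Real.exp (2 * s)) * G s ≤ G₁ s := fun s hs => by
    rw [hG, Finset.mul_sum]
    exact Finset.sum_le_sum fun i _ => (hi s hs i).2.1
  have h2 : ∀ s < Real.log P, 0 ≤ G₂ s + 4 * c * Real.exp (2 * s) * G s := fun s hs => by
    rw [hD]
    exact Finset.sum_nonneg fun i _ => (hi s hs i).2.2.1
  have h3 : ∀ s < Real.log P, G₁ s ^ 2 ≤ (G₂ s + 4 * c * Real.exp (2 * s) * G s) * G s :=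
    fun s hs => by
      rw [hD, hG]
      exact Finset.sum_sq_le_sum_mul_sum_of_sq_le_mul _ (fun i _ => (hi s hs i).2.2.1)
        (fun i _ => (hi s hs i).1) fun i _ => (hi s hs i).2.2.2
  exact ⟨fun s t hst ht => le_exp_mul_of_deriv_ge hc hd1 h0 h1 hst ht,
    fun s t h hst hh ht => mul_le_exp_mul_mul hc hd1 hd2 h0 h2 h3 hst hh ht⟩

lemma exp_neg_two_mul_le_pow {a : ℝ} (ha : 27 / 100 ≤ a) (k : ℕ) :
    Real.exp (-(2 * k)) ≤ a ^ k := by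
  rw [show -(2 * (k : ℝ)) = k * (-2) by ring, Real.exp_nat_mul]
  refine pow_le_pow_left₀ (Real.exp_pos _).le (le_trans ?_ ha) k
  rw [show (-2 : ℝ) = -(1 + 1) by norm_num, Real.exp_neg, Real.exp_add]
  have := Real.exp_one_gt_d9
  rw [inv_le_comm₀ (by positivity) (by norm_num)]
  nlinarith

/-- Doubling and growth of the `L²` masses of a vector-valued solution of the Helmholtz
equation. -/
lemma helmholtz_doubling (hn : 2 ≤ n) {lam : ℝ} (hlam : 0 ≤ lam)
    {ι : Type*} [Fintype ι] {v : ι → EuclideanSpace ℝ (Fin n) → ℝ} (hv : ∀ i, ContDiff ℝ ∞ (v i))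
    (hΔ : ∀ i, ∀ x ∈ ball (0 : EuclideanSpace ℝ (Fin n)) 3, eLap (v i) x = -lam * v i x)
    {A : Set (EuclideanSpace ℝ (Fin n))} (hA : A ⊆ closedBall 0 (1 / 4))
    {r : ℝ} (hr : 0 < r) (hr1 : r ≤ 1 / 16) :
    let J := fun s : Set (EuclideanSpace ℝ (Fin n)) => ∫ x in s, ∑ i, v i x * v i x
    Real.exp (1 - 3 * √lam) * J A ≤ J (ball 0 (5 / 3)) ∧
      J (ball 0 (2 * r)) * J A ≤
        Real.exp (2 + 3 * √lam) * (J (ball 0 (5 / 3)) * J (ball 0 r)) := by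
  intro J
  set q := √lam
  have hq : 0 ≤ q := Real.sqrt_nonneg _
  have hq2 : q * q = lam := Real.mul_self_sqrt hlam
  set l := ⌊q⌋₊
  have hl1 : (l : ℝ) ≤ q := Nat.floor_le hq
  have hl2 : q < l + 1 := Nat.lt_floor_add_one q
  have hk : 1 ≤ l + 1 := by omega
  obtain ⟨hgrow, hconv⟩ := dilatedMean_helmholtz hk hlam three_pos hv hΔ
  set N : EuclideanSpace ℝ (Fin n) → ℝ := fun x => ∑ i, v i x * v i x
  have hN : Continuous N := continuous_finsetSum _ fun i _ =>
    (hv i).continuous.mul (hv i).continuous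
  have hN0 : ∀ x, 0 ≤ N x := fun x => Finset.sum_nonneg fun i _ => mul_self_nonneg _
  have hJ0 : ∀ s, 0 ≤ J s := fun s => integral_nonneg hN0
  set G := dilatedMean (l + 1) N
  have hG0 : ∀ s, 0 ≤ G s := fun s =>
    integral_nonneg fun x => mul_nonneg (hN0 _) (ballWeight_nonneg _ _)
  set c : ℝ := lam / (2 * ((l + 1 : ℕ) + 1)) with hc_def
  have hc : c ≤ q / 2 := by
    rw [hc_def, div_le_div_iff₀ (by positivity) two_pos, ← hq2]
    push_cast
    nlinarith
  have hexp : Real.exp (c * Real.exp (2 * Real.log (5 / 4))) ≤ Real.exp q := by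
    rw [Real.exp_le_exp, two_mul, Real.exp_add, Real.exp_log (by norm_num)]
    linarith
  have hlog : Real.log (5 / 16) + Real.log 4 = Real.log (5 / 4) := by
    rw [← Real.log_mul (by norm_num) (by norm_num)]
    norm_num
  have hlogr : Real.log r + Real.log 4 = Real.log (4 * r) := by
    rw [add_comm, ← Real.log_mul (by norm_num) hr.ne']
  have hlt : Real.log (5 / 4) < Real.log 3 := Real.log_lt_log (by norm_num) (by norm_num)
  have g1 := hgrow (Real.log (5 / 16)) (Real.log (5 / 4))
    (Real.log_le_log (by norm_num) (by norm_num)) hlt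
  have g2 := hconv (Real.log r) (Real.log (5 / 16)) (Real.log 4)
    (Real.log_le_log hr (by linarith)) (Real.log_nonneg (by norm_num)) (by rw [hlog]; exact hlt)
  rw [hlog, hlogr] at g2
  have g1' : G (Real.log (5 / 16)) ≤ Real.exp q * G (Real.log (5 / 4)) :=
    g1.trans (mul_le_mul_of_nonneg_right hexp (hG0 _))
  have g2' : G (Real.log (4 * r)) * G (Real.log (5 / 16)) ≤
      Real.exp q * (G (Real.log r) * G (Real.log (5 / 4))) :=
    g2.trans (mul_le_mul_of_nonneg_right hexp (mul_nonneg (hG0 _) (hG0 _)))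
  have hup : G (Real.log (5 / 4)) ≤ ((5 / 4 : ℝ) ^ n)⁻¹ * J (ball 0 (5 / 3)) := by
    refine (dilatedMean_le_setIntegral_ball hk hN hN0 (by norm_num)).trans ?_
    refine mul_le_mul_of_nonneg_left ?_ (by positivity)
    exact setIntegral_mono_set
      ((hN.continuousOn.integrableOn_compact (isCompact_closedBall 0 _)).mono_set
        ball_subset_closedBall)
      (Filter.Eventually.of_forall hN0)
      (Filter.Eventually.of_forall (ball_subset_ball (by norm_num)))
  have hupr : G (Real.log r) ≤ (r ^ n)⁻¹ * J (ball 0 r) :=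
    dilatedMean_le_setIntegral_ball hk hN hN0 hr
  have hloA : (9 / 25 : ℝ) ^ (l + 1) * (((5 / 16 : ℝ) ^ n)⁻¹ * J A) ≤ G (Real.log (5 / 16)) := by
    have := setIntegral_le_dilatedMean hk hN hN0 (r := 5 / 16) (a := 4 / 5) (by norm_num)
      (by norm_num) (by norm_num) (hA.trans (closedBall_subset_closedBall (by norm_num)))
    norm_num at this ⊢
    exact this
  have hlor : (3 / 4 : ℝ) ^ (l + 1) * (((4 * r) ^ n)⁻¹ * J (ball 0 (2 * r))) ≤
      G (Real.log (4 * r)) := by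
    have := setIntegral_le_dilatedMean hk hN hN0 (r := 4 * r) (a := 1 / 2) (by linarith)
      (by norm_num) (by norm_num) (s := ball 0 (2 * r))
      (ball_subset_closedBall.trans (closedBall_subset_closedBall (by linarith)))
    norm_num at this ⊢
    exact this
  have p4 : (5 / 4 : ℝ) ^ n = 4 ^ n * (5 / 16) ^ n := by
    rw [← mul_pow]
    norm_num
  have hp : (0 : ℝ) < (5 / 16) ^ n := by positivity
  have h4 : (0 : ℝ) < 4 ^ n := by positivity
  have hrn : 0 < r ^ n := by positivity
  constructor
  · have h := (hloA.trans g1').trans (mul_le_mul_of_nonneg_left hup (Real.exp_pos q).le)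
    rw [p4] at h
    have h' : (4 : ℝ) ^ n * (9 / 25) ^ (l + 1) * J A ≤ Real.exp q * J (ball 0 (5 / 3)) := by
      have := mul_le_mul_of_nonneg_left h (mul_pos h4 hp).le
      field_simp at this
      linarith
    have h16 : (16 : ℝ) ≤ 4 ^ n := by
      calc (16 : ℝ) = 4 ^ 2 := by norm_num
        _ ≤ 4 ^ n := pow_le_pow_right₀ (by norm_num) hn
    have hb : Real.exp (1 - 2 * q) ≤ 4 ^ n * (9 / 25) ^ (l + 1) := by
      have e1 : Real.exp (-(2 * q)) ≤ (9 / 25 : ℝ) ^ l :=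
        (Real.exp_le_exp.2 (by linarith)).trans (exp_neg_two_mul_le_pow (by norm_num) l)
      have e2 := Real.exp_one_lt_d9
      calc Real.exp (1 - 2 * q) = Real.exp 1 * Real.exp (-(2 * q)) := by
            rw [← Real.exp_add]; ring_nf
        _ ≤ (16 * (9 / 25)) * (9 / 25 : ℝ) ^ l :=
            mul_le_mul (by linarith) e1 (Real.exp_pos _).le (by norm_num)
        _ = 16 * (9 / 25) ^ (l + 1) := by ring
        _ ≤ _ := mul_le_mul_of_nonneg_right h16 (by positivity)
    have h'' := (mul_le_mul_of_nonneg_right hb (hJ0 A)).trans h'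
    have e3 : Real.exp (1 - 3 * q) = Real.exp (-q) * Real.exp (1 - 2 * q) := by
      rw [← Real.exp_add]; ring_nf
    have e4 : Real.exp (-q) * Real.exp q = 1 := by rw [← Real.exp_add, neg_add_cancel, Real.exp_zero]
    calc Real.exp (1 - 3 * q) * J A = Real.exp (-q) * (Real.exp (1 - 2 * q) * J A) := by
          rw [e3, mul_assoc]
      _ ≤ Real.exp (-q) * (Real.exp q * J (ball 0 (5 / 3))) :=
          mul_le_mul_of_nonneg_left h'' (Real.exp_pos _).le
      _ = J (ball 0 (5 / 3)) := by rw [← mul_assoc, e4, one_mul]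
  · have h := ((mul_le_mul hlor hloA (by have := hJ0 A; positivity) (hG0 _)).trans g2').trans
      (mul_le_mul_of_nonneg_left (mul_le_mul hupr hup (hG0 _)
        (by have := hJ0 (ball 0 r); positivity)) (Real.exp_pos q).le)
    rw [p4, mul_pow] at h
    have h' : (3 / 4 : ℝ) ^ (l + 1) * (9 / 25) ^ (l + 1) * (J (ball 0 (2 * r)) * J A) ≤
        Real.exp q * (J (ball 0 (5 / 3)) * J (ball 0 r)) := by
      have hpos : 0 < 4 ^ n * r ^ n * (5 / 16 : ℝ) ^ n := by positivity
      have := mul_le_mul_of_nonneg_left h hpos.le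
      field_simp at this
      linarith
    rw [← mul_pow] at h'
    have hb : Real.exp (-(2 + 2 * q)) ≤ (3 / 4 * (9 / 25) : ℝ) ^ (l + 1) :=
      (Real.exp_le_exp.2 (by push_cast; linarith)).trans
        (exp_neg_two_mul_le_pow (by norm_num) (l + 1))
    have h'' := (mul_le_mul_of_nonneg_right hb (mul_nonneg (hJ0 (ball 0 (2 * r))) (hJ0 A))).trans h'
    have e3 : Real.exp (2 + 3 * q) = Real.exp (2 + 2 * q) * Real.exp q := by
      rw [← Real.exp_add]; ring_nf
    have e4 : Real.exp (2 + 2 * q) * Real.exp (-(2 + 2 * q)) = 1 := by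
      rw [← Real.exp_add, add_neg_cancel, Real.exp_zero]
    calc J (ball 0 (2 * r)) * J A
        = Real.exp (2 + 2 * q) * (Real.exp (-(2 + 2 * q)) * (J (ball 0 (2 * r)) * J A)) := by
          rw [← mul_assoc (Real.exp _), e4, one_mul]
      _ ≤ Real.exp (2 + 2 * q) * (Real.exp q * (J (ball 0 (5 / 3)) * J (ball 0 r))) :=
          mul_le_mul_of_nonneg_left h'' (Real.exp_pos _).le
      _ = _ := by rw [e3, mul_assoc]

lemma exists_contDiff_eqOn_ball {u : EuclideanSpace ℝ (Fin n) → ℝ}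
    (hu : ContDiffOn ℝ ∞ u (ball 0 8)) :
    ∃ w : EuclideanSpace ℝ (Fin n) → ℝ, ContDiff ℝ ∞ w ∧ Set.EqOn w u (ball 0 3) := by
  let χ : ContDiffBump (0 : EuclideanSpace ℝ (Fin n)) := ⟨3, 4, by norm_num, by norm_num⟩
  refine ⟨fun x => χ x * u x, contDiff_iff_contDiffAt.2 fun x => ?_, fun x hx => ?_⟩
  · by_cases hx : x ∈ ball (0 : EuclideanSpace ℝ (Fin n)) 8
    · exact χ.contDiffAt.mul (hu.contDiffAt (isOpen_ball.mem_nhds hx))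
    · have hx4 : x ∈ (closedBall (0 : EuclideanSpace ℝ (Fin n)) 4)ᶜ := fun h =>
        hx (closedBall_subset_ball (by norm_num) h)
      refine (contDiffAt_const (c := (0 : ℝ))).congr_of_eventuallyEq ?_
      filter_upwards [isClosed_closedBall.isOpen_compl.mem_nhds hx4] with y hy
      rw [Set.mem_compl_iff, mem_closedBall, not_le] at hy
      rw [χ.zero_of_le_dist hy.le, zero_mul]
  · simp only
    rw [χ.one_of_mem_closedBall (ball_subset_closedBall hx), one_mul]

lemma norm_gradient_sq (u : EuclideanSpace ℝ (Fin n) → ℝ) (x : EuclideanSpace ℝ (Fin n)) :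
    ‖gradient u x‖ ^ 2 = ∑ i, pderiv i u x * pderiv i u x := by
  rw [EuclideanSpace.norm_sq_eq]
  refine Finset.sum_congr rfl fun i _ => ?_
  have h : (gradient u x) i = pderiv i u x := by
    have h1 : inner ℝ (gradient u x) (EuclideanSpace.single i 1) = pderiv i u x := by
      rw [gradient, InnerProductSpace.toDual_symm_apply, pderiv]
    rw [← h1, EuclideanSpace.inner_single_right]
    simp
  rw [h, Real.norm_eq_abs, sq_abs, sq]

lemma eLap_pderiv {f : EuclideanSpace ℝ (Fin n) → ℝ} (hf : ContDiff ℝ ∞ f) (i : Fin n)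
    (x : EuclideanSpace ℝ (Fin n)) : eLap (pderiv i f) x = pderiv i (eLap f) x := by
  rw [show eLap f = fun y => ∑ j, pderiv j (pderiv j f) y from rfl,
    pderiv_sum _ fun j => contDiff_pderiv (contDiff_pderiv hf j) j, eLap_eq]
  refine Finset.sum_congr rfl fun j _ => ?_
  rw [show pderiv j (pderiv i f) = pderiv i (pderiv j f) from funext (pderiv_comm hf j i),
    pderiv_comm (contDiff_pderiv hf j)]

lemma setIntegral_annulus_pos {N : EuclideanSpace ℝ (Fin n) → ℝ} (hN : Continuous N)
    (h0 : ∀ x, 0 ≤ N x) {a b : ℝ} (ha : 0 < a) (hab : a < b) {x : EuclideanSpace ℝ (Fin n)}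
    (hx : x ∈ {x : EuclideanSpace ℝ (Fin n) | a ≤ ‖x‖ ∧ ‖x‖ ≤ b}) (hNx : N x ≠ 0) :
    0 < ∫ y in {x : EuclideanSpace ℝ (Fin n) | a ≤ ‖x‖ ∧ ‖x‖ ≤ b}, N y := by
  set A := {x : EuclideanSpace ℝ (Fin n) | a ≤ ‖x‖ ∧ ‖x‖ ≤ b}
  have hx0 : 0 < ‖x‖ := ha.trans_le hx.1
  have hU : IsOpen {y : EuclideanSpace ℝ (Fin n) | N y ≠ 0 ∧ a < ‖y‖ ∧ ‖y‖ < b} :=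
    (hN.isOpen_support).inter
      ((isOpen_lt continuous_const continuous_norm).inter
        (isOpen_lt continuous_norm continuous_const))
  obtain ⟨y, hy⟩ : {y : EuclideanSpace ℝ (Fin n) | N y ≠ 0 ∧ a < ‖y‖ ∧ ‖y‖ < b}.Nonempty := by
    have hline : Continuous fun t : ℝ => x + t • (((a + b) / 2 / ‖x‖ - 1) • x) := by fun_prop
    have hev : ∀ᶠ t in nhdsWithin (0 : ℝ) (Set.Ioi 0),
        N (x + t • (((a + b) / 2 / ‖x‖ - 1) • x)) ≠ 0 := by
      refine ((hN.comp hline).continuousAt.eventually_ne ?_).filter_mono nhdsWithin_le_nhds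
      simpa using hNx
    obtain ⟨t, ht, ht0, ht1⟩ := (hev.and (Ioo_mem_nhdsGT (zero_lt_one' ℝ))).exists
    refine ⟨_, ht, ?_⟩
    have e : x + t • (((a + b) / 2 / ‖x‖ - 1) • x) =
        (((1 - t) * ‖x‖ + t * ((a + b) / 2)) / ‖x‖) • x := by
      rw [smul_smul]
      nth_rewrite 1 [← one_smul ℝ x]
      rw [← add_smul]
      congr 1
      field_simp
      ring
    have hpos : 0 ≤ (1 - t) * ‖x‖ + t * ((a + b) / 2) :=
      add_nonneg (mul_nonneg (by linarith) hx0.le) (mul_nonneg ht0.le (by linarith))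
    have e' : ‖x + t • (((a + b) / 2 / ‖x‖ - 1) • x)‖ = (1 - t) * ‖x‖ + t * ((a + b) / 2) := by
      rw [e, norm_smul, Real.norm_of_nonneg (div_nonneg hpos hx0.le), div_mul_cancel₀ _ hx0.ne']
    rw [e']
    constructor <;> nlinarith [hx.1, hx.2]
  have hAm : MeasurableSet A :=
    ((isClosed_le continuous_const continuous_norm).inter
      (isClosed_le continuous_norm continuous_const)).measurableSet
  have hAi : IntegrableOn N A :=
    (hN.continuousOn.integrableOn_compact (isCompact_closedBall 0 b)).mono_set
      fun z hz => mem_closedBall_zero_iff.2 hz.2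
  rw [setIntegral_pos_iff_support_of_nonneg_ae (Filter.Eventually.of_forall h0) hAi]
  exact (hU.measure_pos volume ⟨y, hy⟩).trans_le
    (measure_mono fun z hz => ⟨hz.1, hz.2.1.le, hz.2.2.le⟩)

end

/-- Small-scale doubling inequality for gradients of eigenfunctions, with the
annulus-to-ball ratio (from the proof of Theorem 3.2, Euclidean case). -/
theorem doubling_gradient_small_scale (n : ℕ) (hn : 2 ≤ n) :
    ∃ R₀ C K : ℝ, 0 < R₀ ∧ 0 < C ∧ 0 < K ∧
      ∀ lam : ℝ, 0 ≤ lam →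
      ∀ u : EuclideanSpace ℝ (Fin n) → ℝ,
        ContDiffOn ℝ (⊤ : ℕ∞) u (ball (0 : EuclideanSpace ℝ (Fin n)) (2 * R₀)) →
        (∀ x ∈ ball (0 : EuclideanSpace ℝ (Fin n)) (2 * R₀), eLap u x + lam * u x = 0) →
        (¬ ∀ x ∈ {x : EuclideanSpace ℝ (Fin n) |
            R₀ / 4 / 8 ≤ ‖x‖ ∧ ‖x‖ ≤ R₀ / 4 / 4}, gradient u x = 0) →
      ∀ r : ℝ, 0 < r → r ≤ R₀ / 4 / 16 →
        eL2On (fun x => ‖gradient u x‖) (ball (0 : EuclideanSpace ℝ (Fin n)) (2 * r)) ≤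
          Real.exp (C * Real.sqrt lam) *
            (eL2On (fun x => ‖gradient u x‖)
                (ball (0 : EuclideanSpace ℝ (Fin n)) (5 * (R₀ / 4) / 3)) /
              eL2On (fun x => ‖gradient u x‖)
                {x : EuclideanSpace ℝ (Fin n) |
                  R₀ / 4 / 8 ≤ ‖x‖ ∧ ‖x‖ ≤ R₀ / 4 / 4}) ^ K *
            eL2On (fun x => ‖gradient u x‖) (ball (0 : EuclideanSpace ℝ (Fin n)) r) := by
  refine ⟨4, 9 / 2, 3, by norm_num, by norm_num, by norm_num, ?_⟩
  intro lam hlam u hu hpde hne r hr hr1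
  rw [show (2 * 4 : ℝ) = 8 by norm_num] at hu hpde
  rw [show (4 / 4 / 8 : ℝ) = 1 / 8 by norm_num, show (4 / 4 / 4 : ℝ) = 1 / 4 by norm_num] at hne ⊢
  rw [show (5 * (4 / 4) / 3 : ℝ) = 5 / 3 by norm_num]
  rw [show (4 / 4 / 16 : ℝ) = 1 / 16 by norm_num] at hr1
  obtain ⟨w, hw, hwu⟩ := exists_contDiff_eqOn_ball hu
  set A := {x : EuclideanSpace ℝ (Fin n) | 1 / 8 ≤ ‖x‖ ∧ ‖x‖ ≤ 1 / 4}
  have hev : ∀ x ∈ ball (0 : EuclideanSpace ℝ (Fin n)) 3, w =ᶠ[nhds x] u := fun x hx =>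
    hwu.eventuallyEq_of_mem (isOpen_ball.mem_nhds hx)
  have hpd : ∀ i, ∀ x ∈ ball (0 : EuclideanSpace ℝ (Fin n)) 3, pderiv i w x = pderiv i u x :=
    fun i x hx => by rw [pderiv, pderiv, (hev x hx).fderiv_eq]
  have hLap : ∀ x ∈ ball (0 : EuclideanSpace ℝ (Fin n)) 3, eLap w x = -lam * w x := by
    intro x hx
    have h1 : eLap w x = eLap u x := by
      rw [eLap_eq, eLap_eq]
      refine Finset.sum_congr rfl fun i _ => ?_
      have : pderiv i w =ᶠ[nhds x] pderiv i u :=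
        Set.EqOn.eventuallyEq_of_mem (hpd i) (isOpen_ball.mem_nhds hx)
      rw [pderiv, this.fderiv_eq, pderiv]
    rw [h1, hwu hx]
    linarith [hpde x (ball_subset_ball (by norm_num) hx)]
  have hLap' : ∀ i, ∀ x ∈ ball (0 : EuclideanSpace ℝ (Fin n)) 3,
      eLap (pderiv i w) x = -lam * pderiv i w x := by
    intro i x hx
    have : eLap w =ᶠ[nhds x] fun y => -lam * w y :=
      Set.EqOn.eventuallyEq_of_mem hLap (isOpen_ball.mem_nhds hx)
    rw [eLap_pderiv hw, pderiv, this.fderiv_eq,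
      fderiv_const_mul (differentiable_of_smooth hw x)]
    simp [pderiv]
  have hA : A ⊆ closedBall 0 (1 / 4) := fun x hx => mem_closedBall_zero_iff.2 hx.2
  obtain ⟨k1, k2⟩ := helmholtz_doubling hn hlam (contDiff_pderiv hw) hLap' hA hr hr1
  set N : EuclideanSpace ℝ (Fin n) → ℝ := fun x => ∑ i, pderiv i w x * pderiv i w x
  beta_reduce at k1 k2
  have hN : Continuous N := continuous_finsetSum _ fun i _ =>
    (contDiff_pderiv hw i).continuous.mul (contDiff_pderiv hw i).continuous
  have hN0 : ∀ x, 0 ≤ N x := fun x => Finset.sum_nonneg fun i _ => mul_self_nonneg _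
  have hgrad : ∀ x ∈ ball (0 : EuclideanSpace ℝ (Fin n)) 3, ‖gradient u x‖ ^ 2 = N x := by
    intro x hx
    rw [norm_gradient_sq]
    exact Finset.sum_congr rfl fun i _ => by rw [hpd i x hx]
  have hAm : MeasurableSet A :=
    ((isClosed_le continuous_const continuous_norm).inter
      (isClosed_le continuous_norm continuous_const)).measurableSet
  have hL2 : ∀ s : Set (EuclideanSpace ℝ (Fin n)), MeasurableSet s → s ⊆ ball 0 3 →
      eL2On (fun x => ‖gradient u x‖) s = √(∫ x in s, N x) := fun s hs hs3 => by
    rw [eL2On, setIntegral_congr_fun hs fun x hx => hgrad x (hs3 hx)]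
  have hA3 : A ⊆ ball 0 3 := hA.trans (closedBall_subset_ball (by norm_num))
  rw [hL2 _ measurableSet_ball (ball_subset_ball (by linarith)),
    hL2 _ measurableSet_ball (ball_subset_ball (by norm_num)), hL2 _ hAm hA3,
    hL2 _ measurableSet_ball (ball_subset_ball (by linarith))]
  have hJ0 : ∀ s : Set (EuclideanSpace ℝ (Fin n)), 0 ≤ ∫ x in s, N x :=
    fun s => integral_nonneg hN0
  have hJA : 0 < ∫ x in A, N x := by
    push Not at hne
    obtain ⟨x, hx, hgx⟩ := hne
    refine setIntegral_annulus_pos hN hN0 (by norm_num) (by norm_num) hx ?_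
    rw [← hgrad x (hA3 hx)]
    exact pow_ne_zero 2 (norm_ne_zero_iff.2 hgx)
  generalize (∫ x in A, N x) = a at *
  have hb0 := hJ0 (ball 0 (5 / 3))
  have hd0 := hJ0 (ball 0 r)
  generalize (∫ x in ball 0 (5 / 3), N x) = b at *
  generalize (∫ x in ball 0 r, N x) = d at *
  generalize (∫ x in ball 0 (2 * r), N x) = e at *
  set q := √lam
  have hab : Real.exp (1 - 3 * q) ≤ b / a := (le_div_iff₀ hJA).2 k1
  have hba : 0 ≤ b / a := div_nonneg hb0 hJA.le
  have he : e ≤ Real.exp (9 * q) * (b / a) ^ 3 * d := by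
    have h1 : Real.exp (2 + 3 * q) ≤ Real.exp (9 * q) * (b / a) ^ 2 := by
      calc Real.exp (2 + 3 * q) = Real.exp (9 * q) * Real.exp (1 - 3 * q) ^ 2 := by
            rw [← Real.exp_nat_mul, ← Real.exp_add]
            congr 1
            push_cast
            ring
        _ ≤ _ := by gcongr
    calc e ≤ Real.exp (2 + 3 * q) * (b * d) / a := (le_div_iff₀ hJA).2 k2
      _ = Real.exp (2 + 3 * q) * (b / a * d) := by ring
      _ ≤ Real.exp (9 * q) * (b / a) ^ 2 * (b / a * d) := by gcongr
      _ = _ := by ring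
  rw [← Real.sqrt_div hb0, show (3 : ℝ) = ((3 : ℕ) : ℝ) by norm_num, Real.rpow_natCast]
  refine Real.sqrt_le_iff.2 ⟨by positivity, he.trans_eq ?_⟩
  rw [mul_pow, mul_pow, Real.sq_sqrt hd0, ← pow_mul, mul_comm 3 2, pow_mul, Real.sq_sqrt hba,
    ← Real.exp_nat_mul]
  congr 3
  push_cast
  ring
end

section
/- Let n ≥ 2. There exist constants C > 0 and C₁ > 0, depending only on n, such that for every λ ≥ 1 and every smooth function u on B(0,1) ⊂ ℝⁿ satisfying Δu + λu = 0 on B(0,1), and every multi-index β with |β| ≥ 1, one has |∂^β u(0)| ≤ β! · C^{|β|} · λ^{|β|/2} · sup_{B(0, C₁/√λ)} |∇u|. -/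
open MeasureTheory Metric

/-- The partial derivative `∂f/∂xᵢ`. -/
noncomputable def ePDeriv {n : ℕ} (i : Fin n) (f : EuclideanSpace ℝ (Fin n) → ℝ) :
    EuclideanSpace ℝ (Fin n) → ℝ :=
  fun x => fderiv ℝ f x (EuclideanSpace.single i 1)

/-- The iterated partial derivative `∂^β f = ∂₀^{β₀} ∂₁^{β₁} ⋯ ∂_{n-1}^{β_{n-1}} f`
associated to a multi-index `β`. -/
noncomputable def eMDeriv {n : ℕ} (β : Fin n → ℕ) (f : EuclideanSpace ℝ (Fin n) → ℝ) :
    EuclideanSpace ℝ (Fin n) → ℝ :=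
  (List.finRange n).foldr (fun i g => (ePDeriv i)^[β i] g) f

section Calculus

/-- At a local maximum, the second derivative is nonpositive. -/
theorem IsLocalMax.second_deriv_nonpos {h h₁ : ℝ → ℝ} {a c : ℝ} (hmax : IsLocalMax h a)
    (hd : ∀ᶠ t in nhds a, HasDerivAt h (h₁ t) t) (hd₁ : HasDerivAt h₁ c a) : c ≤ 0 := by
  by_contra! hc
  have he : deriv h =ᶠ[nhds a] h₁ := hd.mono fun t ht => ht.deriv
  have h2 : deriv (deriv h) a = c := by rw [he.deriv_eq, hd₁.deriv]
  have hmin : IsLocalMin h a :=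
    isLocalMin_of_deriv_deriv_pos (by rw [h2]; exact hc) hmax.deriv_eq_zero
      hd.self_of_nhds.continuousAt
  have hconst : h =ᶠ[nhds a] fun _ => h a := by
    filter_upwards [hmax, hmin] with t h1 h3 using le_antisymm h1 h3
  have h4 : deriv (deriv h) a = 0 := by
    rw [hconst.deriv.deriv_eq]
    simp
  rw [h2] at h4
  exact hc.ne' h4

/-- If `h t ≤ h 0` for small positive `t`, then the derivative at `0` is nonpositive. -/
theorem HasDerivAt.nonpos_of_le_right {h : ℝ → ℝ} {c r : ℝ} (hr : 0 < r)
    (hd : HasDerivAt h c 0) (hle : ∀ t, 0 < t → t < r → h t ≤ h 0) : c ≤ 0 := by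
  have ht := hd.tendsto_slope_zero_right
  refine le_of_tendsto ht ?_
  filter_upwards [Ioo_mem_nhdsGT hr] with t ht
  have := hle t ht.1 ht.2
  rw [zero_add, smul_eq_mul]
  exact mul_nonpos_of_nonneg_of_nonpos (inv_nonneg.2 ht.1.le) (by linarith)

end Calculus

section PartialDerivatives

variable {n : ℕ}

theorem eLap_eq_sum (f : EuclideanSpace ℝ (Fin n) → ℝ) (x : EuclideanSpace ℝ (Fin n)) :
    eLap f x = ∑ i, ePDeriv i (ePDeriv i f) x := rfl

theorem ContDiffOn.ePDeriv {U : Set (EuclideanSpace ℝ (Fin n))} (hU : IsOpen U)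
    {f : EuclideanSpace ℝ (Fin n) → ℝ} (hf : ContDiffOn ℝ (⊤ : ℕ∞) f U) (i : Fin n) :
    ContDiffOn ℝ (⊤ : ℕ∞) (ePDeriv i f) U :=
  (hf.fderiv_of_isOpen hU (m := (⊤ : ℕ∞)) (by simp)).clm_apply contDiffOn_const

theorem ePDeriv_congr {f g : EuclideanSpace ℝ (Fin n) → ℝ} {x : EuclideanSpace ℝ (Fin n)}
    (h : f =ᶠ[nhds x] g) (i : Fin n) : ePDeriv i f =ᶠ[nhds x] ePDeriv i g := by
  filter_upwards [h.fderiv (𝕜 := ℝ)] with y hy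
  simp only [ePDeriv, hy]

theorem ePDeriv_comm {U : Set (EuclideanSpace ℝ (Fin n))} (hU : IsOpen U)
    {f : EuclideanSpace ℝ (Fin n) → ℝ} (hf : ContDiffOn ℝ (⊤ : ℕ∞) f U) (i j : Fin n)
    {x : EuclideanSpace ℝ (Fin n)} (hx : x ∈ U) :
    ePDeriv i (ePDeriv j f) x = ePDeriv j (ePDeriv i f) x := by
  have hfx : ContDiffAt ℝ (⊤ : ℕ∞) f x := hf.contDiffAt (hU.mem_nhds hx)
  have hs : IsSymmSndFDerivAt ℝ f x := hfx.isSymmSndFDerivAt (by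
    simp only [minSmoothness_of_isRCLikeNormedField]
    exact WithTop.coe_le_coe.2 (le_top (a := (2 : ℕ∞))))
  have hd : DifferentiableAt ℝ (fderiv ℝ f) x :=
    (hfx.fderiv_right (m := 1) (WithTop.coe_le_coe.2 (le_top (a := (2 : ℕ∞))))).differentiableAt one_ne_zero
  have key : ∀ a b : Fin n, ePDeriv a (ePDeriv b f) x =
      fderiv ℝ (fderiv ℝ f) x (EuclideanSpace.single a 1) (EuclideanSpace.single b 1) := by
    intro a b
    unfold ePDeriv
    rw [fderiv_clm_apply hd (differentiableAt_const _)]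
    simp
  rw [key, key]
  exact hs _ _

/-- Partial derivatives preserve the Helmholtz equation. -/
theorem eLap_ePDeriv_add_mul_eq_zero {U : Set (EuclideanSpace ℝ (Fin n))} (hU : IsOpen U)
    {f : EuclideanSpace ℝ (Fin n) → ℝ} (hf : ContDiffOn ℝ (⊤ : ℕ∞) f U) {lam : ℝ}
    (heq : ∀ x ∈ U, eLap f x + lam * f x = 0) (j : Fin n) :
    ∀ x ∈ U, eLap (ePDeriv j f) x + lam * ePDeriv j f x = 0 := by
  intro x hx
  have hdiff : ∀ g : EuclideanSpace ℝ (Fin n) → ℝ, ContDiffOn ℝ (⊤ : ℕ∞) g U →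
      DifferentiableAt ℝ g x := fun g hg =>
    (hg.contDiffAt (hU.mem_nhds hx)).differentiableAt (by simp)
  have h1 : eLap (ePDeriv j f) x = ∑ i, ePDeriv j (ePDeriv i (ePDeriv i f)) x := by
    rw [eLap_eq_sum]
    refine Finset.sum_congr rfl fun i _ => ?_
    have : ePDeriv i (ePDeriv j f) =ᶠ[nhds x] ePDeriv j (ePDeriv i f) := by
      filter_upwards [hU.mem_nhds hx] with y hy using ePDeriv_comm hU hf i j hy
    rw [(ePDeriv_congr this i).self_of_nhds]
    exact ePDeriv_comm hU (hf.ePDeriv hU i) i j hx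
  have h2 : ePDeriv j (eLap f) x = ∑ i, ePDeriv j (ePDeriv i (ePDeriv i f)) x := by
    have : eLap f = fun y => ∑ i, ePDeriv i (ePDeriv i f) y := funext fun y => eLap_eq_sum f y
    rw [this]
    change fderiv ℝ (fun y => ∑ i, ePDeriv i (ePDeriv i f) y) x (EuclideanSpace.single j 1) = _
    rw [fderiv_fun_sum fun i _ => hdiff _ ((hf.ePDeriv hU i).ePDeriv hU i),
      sum_apply]
    rfl
  have h3 : eLap f =ᶠ[nhds x] fun y => -lam * f y := by
    filter_upwards [hU.mem_nhds hx] with y hy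
    linarith [heq y hy]
  have h4 : ePDeriv j (fun y => -lam * f y) x = -lam * ePDeriv j f x := by
    unfold ePDeriv
    rw [fderiv_const_mul (hdiff f hf)]
    simp
  rw [h1, ← h2, (ePDeriv_congr h3 j).self_of_nhds, h4]
  ring

theorem ePDeriv_neg (f : EuclideanSpace ℝ (Fin n) → ℝ) (i : Fin n) :
    ePDeriv i (fun x => -f x) = fun x => -ePDeriv i f x := by
  funext x
  simp [ePDeriv, fderiv_fun_neg]

theorem eLap_neg (f : EuclideanSpace ℝ (Fin n) → ℝ) (x : EuclideanSpace ℝ (Fin n)) :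
    eLap (fun x => -f x) x = -eLap f x := by
  simp only [eLap_eq_sum, ePDeriv_neg, Finset.sum_neg_distrib]

/-- The derivative of a function along a line in a coordinate direction. -/
theorem hasDerivAt_comp_line {U : Set (EuclideanSpace ℝ (Fin n))} (hU : IsOpen U)
    {f : EuclideanSpace ℝ (Fin n) → ℝ} (hf : ContDiffOn ℝ (⊤ : ℕ∞) f U)
    (q : EuclideanSpace ℝ (Fin n)) (s t : ℝ) (j : Fin n)
    (hq : q + (s * t) • EuclideanSpace.single j 1 ∈ U) :
    HasDerivAt (fun t : ℝ => f (q + (s * t) • EuclideanSpace.single j 1))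
      (s * ePDeriv j f (q + (s * t) • EuclideanSpace.single j 1)) t := by
  have hfd : HasFDerivAt f (fderiv ℝ f (q + (s * t) • EuclideanSpace.single j 1))
      (q + (s * t) • EuclideanSpace.single j 1) :=
    ((hf.contDiffAt (hU.mem_nhds hq)).differentiableAt (by simp)).hasFDerivAt
  have hl : HasDerivAt (fun t : ℝ => q + (s * t) • (EuclideanSpace.single j 1 :
      EuclideanSpace ℝ (Fin n))) (s • EuclideanSpace.single j 1) t := by
    have := (((hasDerivAt_id t).const_mul s).smul_const
      (EuclideanSpace.single j 1 : EuclideanSpace ℝ (Fin n))).const_add q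
    simpa using this
  refine (hfd.comp_hasDerivAt t hl).congr_deriv ?_
  rw [map_smul, smul_eq_mul]
  rfl

theorem eventually_line_mem {U : Set (EuclideanSpace ℝ (Fin n))} (hU : IsOpen U)
    {q : EuclideanSpace ℝ (Fin n)} (hq : q ∈ U) (s : ℝ) (j : Fin n) :
    ∀ᶠ t : ℝ in nhds 0, q + (s * t) • EuclideanSpace.single j (1 : ℝ) ∈ U := by
  have hc : Continuous fun t : ℝ => q + (s * t) • EuclideanSpace.single j (1 : ℝ) := by fun_prop
  exact hc.continuousAt.eventually_mem (hU.mem_nhds (by simpa using hq))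

end PartialDerivatives

section GradientEstimate

variable {n : ℕ}

theorem norm_sub_two_mul_smul_single (y : EuclideanSpace ℝ (Fin n)) (i : Fin n) :
    ‖y - (2 * y i) • EuclideanSpace.single i (1 : ℝ)‖ = ‖y‖ := by
  have h : ‖y - (2 * y i) • EuclideanSpace.single i (1 : ℝ)‖ ^ 2 = ‖y‖ ^ 2 := by
    rw [norm_sub_sq_real, inner_smul_right, EuclideanSpace.inner_single_right, norm_smul]
    simp [mul_pow]
    ring
  exact (pow_left_inj₀ (norm_nonneg _) (norm_nonneg _) two_ne_zero).1 h

theorem norm_add_smul_single_sq (y : EuclideanSpace ℝ (Fin n)) (t : ℝ) (j : Fin n) :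
    ‖y + t • EuclideanSpace.single j (1 : ℝ)‖ ^ 2 = ‖y‖ ^ 2 + 2 * y j * t + t ^ 2 := by
  rw [norm_add_sq_real, inner_smul_right, EuclideanSpace.inner_single_right, norm_smul]
  simp
  ring

/-- One-sided interior gradient estimate for the Helmholtz equation, by comparing the odd
reflection of `f` with a quadratic barrier on a half ball. -/
theorem ePDeriv_le_of_helmholtz {U : Set (EuclideanSpace ℝ (Fin n))} (hU : IsOpen U)
    {f : EuclideanSpace ℝ (Fin n) → ℝ} (hf : ContDiffOn ℝ (⊤ : ℕ∞) f U) {lam : ℝ}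
    (hlam : 0 ≤ lam) (heq : ∀ x ∈ U, eLap f x + lam * f x = 0)
    {p : EuclideanSpace ℝ (Fin n)} {r M : ℝ} (hr : 0 < r) (hM : 0 < M)
    (hball : closedBall p r ⊆ U) (hbd : ∀ x ∈ closedBall p r, |f x| ≤ M) (i : Fin n) :
    ePDeriv i f p ≤ (n + 1) * M / r + lam * M * r / 2 := by
  set A : ℝ := 2 * M / r ^ 2 with hA
  have hApos : 0 < A := by positivity
  have hAr : A * r ^ 2 = 2 * M := by rw [hA]; field_simp
  set E : ℝ := A * (n + 1) + lam * M with hE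
  have hEpos : 0 < E := by positivity
  let σ : EuclideanSpace ℝ (Fin n) → EuclideanSpace ℝ (Fin n) :=
    fun y => y - (2 * y i) • EuclideanSpace.single i (1 : ℝ)
  have hσ : ∀ y, ‖σ y‖ = ‖y‖ := fun y => norm_sub_two_mul_smul_single y i
  have hmem : ∀ y : EuclideanSpace ℝ (Fin n), ‖y‖ ≤ r → p + y ∈ closedBall p r := by
    intro y hy
    simpa [mem_closedBall, dist_eq_norm] using hy
  have hmemU : ∀ y : EuclideanSpace ℝ (Fin n), ‖y‖ ≤ r → p + y ∈ U :=
    fun y hy => hball (hmem y hy)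
  let g : EuclideanSpace ℝ (Fin n) → ℝ := fun y =>
    f (p + y) - f (p + σ y) - A * ‖y‖ ^ 2 - E * r * y i + E * (y i) ^ 2
  let δ : Fin n → ℝ := fun j => if j = i then 1 else 0
  have hδ : ∀ j, (1 - 2 * δ j) * (1 - 2 * δ j) = 1 := by
    intro j
    simp only [δ]
    split_ifs <;> norm_num
  have hline : ∀ (y : EuclideanSpace ℝ (Fin n)) (j : Fin n) (t : ℝ),
      g (y + t • EuclideanSpace.single j 1) =
      f (p + y + (1 * t) • EuclideanSpace.single j 1)
        - f (p + σ y + ((1 - 2 * δ j) * t) • EuclideanSpace.single j 1)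
        - A * (‖y‖ ^ 2 + 2 * y j * t + t ^ 2) - E * r * (y i + t * δ j)
        + E * (y i + t * δ j) ^ 2 := by
    intro y j t
    have hcoord : (y + t • EuclideanSpace.single j (1 : ℝ)) i = y i + t * δ j := by
      by_cases hji : j = i
      · subst hji; simp [δ]
      · simp [δ, hji, Ne.symm hji]
    have hσl : p + σ (y + t • EuclideanSpace.single j 1) =
        p + σ y + ((1 - 2 * δ j) * t) • EuclideanSpace.single j 1 := by
      simp only [σ, hcoord]
      by_cases hji : j = i
      · subst hji
        simp only [δ, if_true]
        module
      · simp only [δ, if_neg hji]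
        module
    simp only [g, hσl]
    rw [norm_add_smul_single_sq, hcoord, one_mul, ← add_assoc]
  have hderiv : ∀ (y : EuclideanSpace ℝ (Fin n)) (j : Fin n) (t : ℝ),
      p + y + (1 * t) • EuclideanSpace.single j 1 ∈ U →
      p + σ y + ((1 - 2 * δ j) * t) • EuclideanSpace.single j 1 ∈ U →
      HasDerivAt (fun t : ℝ => g (y + t • EuclideanSpace.single j 1))
        (1 * ePDeriv j f (p + y + (1 * t) • EuclideanSpace.single j 1)
          - (1 - 2 * δ j) *
            ePDeriv j f (p + σ y + ((1 - 2 * δ j) * t) • EuclideanSpace.single j 1)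
          - A * (2 * y j + 2 * t) - E * r * δ j + E * (2 * (y i + t * δ j) * δ j)) t := by
    intro y j t h1 h2
    simp only [hline]
    have d1 := hasDerivAt_comp_line hU hf (p + y) 1 t j h1
    have d2 := hasDerivAt_comp_line hU hf (p + σ y) (1 - 2 * δ j) t j h2
    have d3 : HasDerivAt (fun t : ℝ => ‖y‖ ^ 2 + 2 * y j * t + t ^ 2) (2 * y j + 2 * t) t := by
      have := (((hasDerivAt_id t).const_mul (2 * y j)).const_add (‖y‖ ^ 2)).add
        ((hasDerivAt_id t).pow 2)
      refine this.congr_deriv ?_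
      simp
    have d4 : HasDerivAt (fun t : ℝ => y i + t * δ j) (δ j) t := by
      simpa using ((hasDerivAt_id t).mul_const (δ j)).const_add (y i)
    refine ((((d1.sub d2).sub (d3.const_mul A)).sub (d4.const_mul (E * r))).add
      ((d4.pow 2).const_mul E)).congr_deriv ?_
    simp
  have hderiv2 : ∀ (y : EuclideanSpace ℝ (Fin n)) (j : Fin n), p + y ∈ U → p + σ y ∈ U →
      HasDerivAt (fun t : ℝ =>
        (1 * ePDeriv j f (p + y + (1 * t) • EuclideanSpace.single j 1)
          - (1 - 2 * δ j) *
            ePDeriv j f (p + σ y + ((1 - 2 * δ j) * t) • EuclideanSpace.single j 1)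
          - A * (2 * y j + 2 * t) - E * r * δ j + E * (2 * (y i + t * δ j) * δ j)))
        (ePDeriv j (ePDeriv j f) (p + y) - ePDeriv j (ePDeriv j f) (p + σ y)
          - 2 * A + 2 * E * δ j) 0 := by
    intro y j h1 h2
    have d1 := hasDerivAt_comp_line hU (hf.ePDeriv hU j) (p + y) 1 0 j (by simpa using h1)
    have d2 := hasDerivAt_comp_line hU (hf.ePDeriv hU j) (p + σ y) (1 - 2 * δ j) 0 j
      (by simpa using h2)
    have d3 : HasDerivAt (fun t : ℝ => 2 * y j + 2 * t) 2 0 := by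
      simpa using ((hasDerivAt_id (0 : ℝ)).const_mul 2).const_add (2 * y j)
    have d4 : HasDerivAt (fun t : ℝ => 2 * (y i + t * δ j) * δ j) (2 * δ j * δ j) 0 := by
      have := ((((hasDerivAt_id (0 : ℝ)).mul_const (δ j)).const_add (y i)).const_mul 2).mul_const
        (δ j)
      simpa using this
    refine ((((d1.const_mul 1).sub (d2.const_mul (1 - 2 * δ j))).sub
      (d3.const_mul A)).sub_const (E * r * δ j)).add (d4.const_mul E) |>.congr_deriv ?_
    have hδ2 : δ j * δ j = δ j := by simp only [δ]; split_ifs <;> norm_num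
    simp only [mul_zero, zero_smul, add_zero, one_mul]
    linear_combination (-ePDeriv j (ePDeriv j f) (p + σ y)) * hδ j + 2 * E * hδ2
  let D : Set (EuclideanSpace ℝ (Fin n)) := closedBall 0 r ∩ {y | 0 ≤ y i}
  have hDn : ∀ y ∈ D, ‖y‖ ≤ r := fun y hy => by simpa using hy.1
  have hi_cont : Continuous fun y : EuclideanSpace ℝ (Fin n) => y i := by fun_prop
  have hDc : IsCompact D :=
    (isCompact_closedBall 0 r).inter_right (isClosed_le continuous_const hi_cont)
  have h0D : (0 : EuclideanSpace ℝ (Fin n)) ∈ D := ⟨by simp [hr.le], by simp⟩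
  have hσc : Continuous σ := by
    simp only [σ]
    fun_prop
  have hgc : ContinuousOn g D := by
    have c1 : ContinuousOn (fun y => f (p + y)) D :=
      hf.continuousOn.comp (by fun_prop) fun y hy => hmemU y (hDn y hy)
    have c2 : ContinuousOn (fun y => f (p + σ y)) D :=
      hf.continuousOn.comp (continuous_const.add hσc).continuousOn
        fun y hy => hmemU _ ((hσ y).trans_le (hDn y hy))
    exact (((c1.sub c2).sub (by fun_prop)).sub (by fun_prop)).add (by fun_prop)
  obtain ⟨y, hyD, hymax⟩ := hDc.exists_isMaxOn ⟨0, h0D⟩ hgc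
  have hy_nonneg : 0 ≤ y i := hyD.2
  have hyn := hDn y hyD
  have hyi_le : y i ≤ r := by
    exact (le_abs_self _).trans ((PiLp.norm_apply_le y i).trans hyn)
  have hb1 := abs_le.1 (hbd _ (hmem y hyn))
  have hb2 := abs_le.1 (hbd _ (hmem (σ y) ((hσ y).trans_le hyn)))
  have hgy : g y ≤ 0 := by
    rcases hy_nonneg.eq_or_lt with h0 | hpos
    · have hσy : σ y = y := by simp [σ, ← h0]
      simp only [g, hσy, ← h0]
      nlinarith [sq_nonneg ‖y‖]
    rcases hyn.eq_or_lt with h0 | hlt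
    · simp only [g, h0, hAr]
      nlinarith [mul_nonneg (mul_nonneg hEpos.le hpos.le) (sub_nonneg.2 hyi_le)]
    exfalso
    have hDy : ∀ᶠ z in nhds y, z ∈ D := by
      have e1 : ∀ᶠ z in nhds y, ‖z‖ < r := continuous_norm.continuousAt.eventually_lt_const hlt
      have e2 : ∀ᶠ z : EuclideanSpace ℝ (Fin n) in nhds y, 0 < z i :=
        hi_cont.continuousAt.eventually_const_lt hpos
      filter_upwards [e1, e2] with z h1 h2 using ⟨by simpa using h1.le, h2.le⟩
    have hU1 := hmemU y hyn
    have hU2 := hmemU (σ y) ((hσ y).trans_le hyn)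
    have hj : ∀ j, ePDeriv j (ePDeriv j f) (p + y) - ePDeriv j (ePDeriv j f) (p + σ y)
          - 2 * A + 2 * E * δ j ≤ 0 := by
      intro j
      refine IsLocalMax.second_deriv_nonpos (a := 0)
        (h := fun t : ℝ => g (y + t • EuclideanSpace.single j 1)) ?_ ?_ (hderiv2 y j hU1 hU2)
      · have hc : Continuous fun t : ℝ => y + t • EuclideanSpace.single j (1 : ℝ) := by fun_prop
        have ht : Filter.Tendsto (fun t : ℝ => y + t • EuclideanSpace.single j (1 : ℝ))
            (nhds 0) (nhds y) := by
          simpa using hc.tendsto 0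
        filter_upwards [ht.eventually hDy] with t ht
        simpa using hymax ht
      · filter_upwards [eventually_line_mem hU hU1 1 j,
          eventually_line_mem hU hU2 (1 - 2 * δ j) j] with t h1 h2 using hderiv y j t h1 h2
    have hsum := Finset.sum_nonpos fun j (_ : j ∈ Finset.univ) => hj j
    have hδsum : ∑ j, 2 * E * δ j = 2 * E := by
      rw [← Finset.mul_sum]
      simp [δ]
    rw [Finset.sum_add_distrib, hδsum, Finset.sum_sub_distrib, Finset.sum_sub_distrib,
      ← eLap_eq_sum, ← eLap_eq_sum] at hsum
    simp only [Finset.sum_const, Finset.card_univ, Fintype.card_fin, nsmul_eq_mul] at hsum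
    have e1 := heq _ hU1
    have e2 := heq _ hU2
    have b1 := mul_le_mul_of_nonneg_left hb1.2 hlam
    have b2 := mul_le_mul_of_nonneg_left hb2.1 hlam
    nlinarith
  have hg0 : g 0 = 0 := by simp [g, σ]
  have hp : p ∈ U := hball (mem_closedBall_self hr.le)
  have hσ0 : σ 0 = 0 := by simp [σ]
  have hd0 := hderiv 0 i 0 (by simpa using hp) (by simpa [hσ0] using hp)
  have hle := hd0.nonpos_of_le_right hr (by
    intro t ht htr
    rw [zero_add, zero_smul, add_zero, hg0]
    have htD : t • EuclideanSpace.single i (1 : ℝ) ∈ D :=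
      ⟨by simp [norm_smul, abs_of_pos ht, htr.le], by simp [ht.le]⟩
    exact (hymax htD).trans hgy)
  simp only [hσ0, mul_zero, zero_smul, add_zero, δ, if_true, PiLp.zero_apply] at hle
  have hEr : E * r = 2 * ((n + 1) * M / r + lam * M * r / 2) := by
    rw [hE, hA]
    field_simp
  linarith

/-- Interior gradient estimate for the Helmholtz equation at scales below the wavelength. -/
theorem abs_ePDeriv_le_of_helmholtz {U : Set (EuclideanSpace ℝ (Fin n))} (hU : IsOpen U)
    {f : EuclideanSpace ℝ (Fin n) → ℝ} (hf : ContDiffOn ℝ (⊤ : ℕ∞) f U) {lam : ℝ}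
    (hlam : 0 ≤ lam) (heq : ∀ x ∈ U, eLap f x + lam * f x = 0)
    {p : EuclideanSpace ℝ (Fin n)} {r M : ℝ} (hr : 0 < r) (hlr : lam * r ^ 2 ≤ 1) (hM : 0 < M)
    (hball : closedBall p r ⊆ U) (hbd : ∀ x ∈ closedBall p r, |f x| ≤ M) (i : Fin n) :
    |ePDeriv i f p| ≤ (n + 2) / r * M := by
  have key : (n + 1) * M / r + lam * M * r / 2 ≤ (n + 2) / r * M := by
    have h : lam * r ≤ 1 / r := by
      rw [le_div_iff₀ hr]
      linarith
    have h2 := mul_le_mul_of_nonneg_right h hM.le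
    have h3 : (n + 2 : ℝ) / r * M = (n + 1) * M / r + 1 / r * M := by ring
    have h4 : 0 ≤ lam * r * M := by positivity
    rw [h3]
    linarith
  refine abs_le.2 ⟨?_, (ePDeriv_le_of_helmholtz hU hf hlam heq hr hM hball hbd i).trans key⟩
  have := (ePDeriv_le_of_helmholtz hU hf.neg hlam (f := fun x => -f x)
    (fun x hx => by rw [eLap_neg]; linarith [heq x hx]) hr hM hball
    (fun x hx => by rw [abs_neg]; exact hbd x hx) i).trans key
  rw [ePDeriv_neg] at this
  linarith

/-- Iterated partial derivatives of a Helmholtz solution, losing a factor `(n + 2) / d` for each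
derivative and a distance `d` in the radius of the ball. -/
theorem abs_foldr_ePDeriv_le {U : Set (EuclideanSpace ℝ (Fin n))} (hU : IsOpen U)
    {f : EuclideanSpace ℝ (Fin n) → ℝ} (hf : ContDiffOn ℝ (⊤ : ℕ∞) f U) {lam : ℝ}
    (hlam : 0 ≤ lam) (heq : ∀ x ∈ U, eLap f x + lam * f x = 0)
    {p : EuclideanSpace ℝ (Fin n)} {d M : ℝ} (hd : 0 < d) (hld : lam * d ^ 2 ≤ 1) (hM : 0 < M)
    (L : List (Fin n)) :
    ContDiffOn ℝ (⊤ : ℕ∞) (L.foldr ePDeriv f) U ∧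
    (∀ x ∈ U, eLap (L.foldr ePDeriv f) x + lam * L.foldr ePDeriv f x = 0) ∧
    ∀ ρ, 0 ≤ ρ → closedBall p (ρ + L.length * d) ⊆ U →
      (∀ x ∈ closedBall p (ρ + L.length * d), |f x| ≤ M) →
      ∀ x ∈ closedBall p ρ, |L.foldr ePDeriv f x| ≤ ((n + 2) / d) ^ L.length * M := by
  induction L with
  | nil => exact ⟨hf, heq, fun ρ _ _ hb x hx => by simpa using hb x (by simpa using hx)⟩
  | cons i L ih =>
    obtain ⟨h1, h2, h3⟩ := ih
    refine ⟨h1.ePDeriv hU i, eLap_ePDeriv_add_mul_eq_zero hU h1 h2 i, ?_⟩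
    intro ρ hρ hsub hb x hx
    have hlen : ρ + ((i :: L).length : ℝ) * d = ρ + d + L.length * d := by
      push_cast [List.length_cons]
      ring
    rw [hlen] at hsub hb
    have hxd : closedBall x d ⊆ closedBall p (ρ + d) :=
      closedBall_subset_closedBall' (by rw [mem_closedBall] at hx; linarith)
    have h4 := h3 (ρ + d) (by positivity) hsub hb
    have hpos : 0 ≤ (L.length : ℝ) * d := by positivity
    have := abs_ePDeriv_le_of_helmholtz hU h1 hlam h2 hd hld
      (M := ((n + 2) / d) ^ L.length * M) (by positivity)
      (hxd.trans ((closedBall_subset_closedBall (by linarith)).trans hsub))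
      (fun y hy => h4 y (hxd hy)) i
    rw [List.foldr_cons, List.length_cons, pow_succ']
    linarith

end GradientEstimate

section MultiIndices

variable {n : ℕ}

theorem eMDeriv_eq_foldr (β : Fin n → ℕ) :
    ∃ L : List (Fin n), L.length = ∑ i, β i ∧
      ∀ f : EuclideanSpace ℝ (Fin n) → ℝ, eMDeriv β f = L.foldr ePDeriv f := by
  have hrep : ∀ (k : ℕ) (i : Fin n) (f : EuclideanSpace ℝ (Fin n) → ℝ),
      (ePDeriv i)^[k] f = (List.replicate k i).foldr ePDeriv f := by
    intro k i f
    induction k with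
    | zero => rfl
    | succ k ih => rw [Function.iterate_succ_apply', ih, List.replicate_succ, List.foldr_cons]
  have key : ∀ l : List (Fin n), ∃ L : List (Fin n), L.length = (l.map β).sum ∧
      ∀ f : EuclideanSpace ℝ (Fin n) → ℝ,
        l.foldr (fun i g => (ePDeriv i)^[β i] g) f = L.foldr ePDeriv f := by
    intro l
    induction l with
    | nil => exact ⟨[], rfl, fun f => rfl⟩
    | cons i l ih =>
      obtain ⟨L, hL, hf⟩ := ih
      refine ⟨List.replicate (β i) i ++ L, by simp [hL], fun f => ?_⟩
      rw [List.foldr_cons, hf, hrep, List.foldr_append]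
  obtain ⟨L, hL, hf⟩ := key (List.finRange n)
  exact ⟨L, by rw [hL, ← List.sum_ofFn, List.ofFn_eq_map], hf⟩

theorem factorial_sum_le_two_pow_mul_prod {ι : Type*} (s : Finset ι) (β : ι → ℕ) :
    (∑ i ∈ s, β i).factorial ≤
      (2 ^ s.card) ^ (∑ i ∈ s, β i) * ∏ i ∈ s, (β i).factorial := by
  classical
  induction s using Finset.induction_on with
  | empty => simp
  | insert a s ha ih =>
    rw [Finset.sum_insert ha, Finset.prod_insert ha, Finset.card_insert_of_notMem ha]
    set b := ∑ i ∈ s, β i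
    have h1 : (β a + b).factorial = (β a + b).choose (β a) * (β a).factorial * b.factorial := by
      simpa using (Nat.choose_mul_factorial_mul_factorial (Nat.le_add_right (β a) b)).symm
    have h2 := Nat.choose_le_two_pow (β a + b) (β a)
    have h3 : (2 ^ s.card) ^ b ≤ (2 ^ s.card) ^ (β a + b) :=
      Nat.pow_le_pow_right (by positivity) (by omega)
    calc (β a + b).factorial = (β a + b).choose (β a) * (β a).factorial * b.factorial := h1
      _ ≤ 2 ^ (β a + b) * (β a).factorial *
          ((2 ^ s.card) ^ (β a + b) * ∏ i ∈ s, (β i).factorial) := by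
        gcongr
        exact ih.trans (Nat.mul_le_mul_right _ h3)
      _ = _ := by
        rw [pow_succ 2 s.card, mul_pow]
        ring

theorem sum_pow_sum_le (β : Fin n → ℕ) :
    ((∑ i, β i : ℕ) : ℝ) ^ (∑ i, β i) ≤
      (Real.exp 1 * 2 ^ n) ^ (∑ i, β i) * (∏ i, (β i).factorial : ℕ) := by
  set k := ∑ i, β i with hk
  have h1 := Real.pow_div_factorial_le_exp (x := (k : ℝ)) (by positivity) k
  rw [div_le_iff₀ (by positivity)] at h1
  have h2 : (k.factorial : ℝ) ≤ (2 ^ n) ^ k * (∏ i, (β i).factorial : ℕ) := by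
    have := factorial_sum_le_two_pow_mul_prod Finset.univ β
    rw [Finset.card_univ, Fintype.card_fin] at this
    exact_mod_cast this
  have h3 : Real.exp k = Real.exp 1 ^ k := by rw [← Real.exp_nat_mul, mul_one]
  rw [h3] at h1
  calc (k : ℝ) ^ k ≤ Real.exp 1 ^ k * k.factorial := h1
    _ ≤ Real.exp 1 ^ k * ((2 ^ n) ^ k * (∏ i, (β i).factorial : ℕ)) := by gcongr
    _ = _ := by rw [mul_pow]; ring

end MultiIndices

theorem abs_ePDeriv_le_norm_gradient {n : ℕ} (f : EuclideanSpace ℝ (Fin n) → ℝ) (i : Fin n)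
    (x : EuclideanSpace ℝ (Fin n)) : |ePDeriv i f x| ≤ ‖gradient f x‖ := by
  have h : ‖gradient f x‖ = ‖fderiv ℝ f x‖ := by simp [gradient]
  rw [h]
  simpa [ePDeriv] using (fderiv ℝ f x).le_opNorm (EuclideanSpace.single i 1)

theorem bddAbove_norm_gradient {n : ℕ} {f : EuclideanSpace ℝ (Fin n) → ℝ}
    (hf : ContDiffOn ℝ (⊤ : ℕ∞) f (ball (0 : EuclideanSpace ℝ (Fin n)) 1)) {R : ℝ} (hR : R < 1) :
    BddAbove ((fun x => ‖gradient f x‖) '' ball (0 : EuclideanSpace ℝ (Fin n)) R) := by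
  have hc : ContinuousOn (fun x => ‖gradient f x‖) (closedBall 0 R) := by
    have h : (fun x => ‖gradient f x‖) = fun x => ‖fderiv ℝ f x‖ := by
      funext x
      simp [gradient]
    rw [h]
    exact ((hf.continuousOn_fderiv_of_isOpen isOpen_ball (by simp)).mono
      (closedBall_subset_ball hR)).norm
  exact ((isCompact_closedBall _ _).bddAbove_image hc).mono (Set.image_mono ball_subset_closedBall)

/-- Quantitative analytic estimates on all derivatives of a Laplace eigenfunction at
the origin (Euclidean-metric case of Lemma 4.2). -/
theorem eigenfunction_derivative_bounds (n : ℕ) (hn : 2 ≤ n) :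
    ∃ C C₁ : ℝ, 0 < C ∧ 0 < C₁ ∧
      ∀ lam : ℝ, 1 ≤ lam →
      ∀ u : EuclideanSpace ℝ (Fin n) → ℝ,
        ContDiffOn ℝ (⊤ : ℕ∞) u (ball (0 : EuclideanSpace ℝ (Fin n)) 1) →
        (∀ x ∈ ball (0 : EuclideanSpace ℝ (Fin n)) 1, eLap u x + lam * u x = 0) →
      ∀ β : Fin n → ℕ, 1 ≤ ∑ i, β i →
        |eMDeriv β u 0| ≤
          (∏ i, Nat.factorial (β i) : ℕ) * C ^ (∑ i, β i) *
            lam ^ ((∑ i, β i : ℝ) / 2) *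
            sSup ((fun x => ‖gradient u x‖) ''
              ball (0 : EuclideanSpace ℝ (Fin n)) (C₁ / Real.sqrt lam)) := by
  refine ⟨4 * (n + 2) * (Real.exp 1 * 2 ^ n), 1 / 2, by positivity, by norm_num, ?_⟩
  intro lam hlam u hu heq β hβ
  have hsq1 : 1 ≤ Real.sqrt lam := Real.one_le_sqrt.2 hlam
  have hsqpos : 0 < Real.sqrt lam := by linarith
  have hsq : Real.sqrt lam ^ 2 = lam := Real.sq_sqrt (by linarith)
  set R : ℝ := 1 / 2 / Real.sqrt lam with hR
  have hRpos : 0 < R := by positivity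
  have hR1 : R < 1 := by
    rw [hR, div_lt_one hsqpos]
    linarith
  have hlR : lam * R ^ 2 ≤ 1 := by
    rw [hR, div_pow, hsq]
    field_simp
    norm_num
  set S := sSup ((fun x => ‖gradient u x‖) '' ball (0 : EuclideanSpace ℝ (Fin n)) R) with hS
  have hSle : ∀ x ∈ ball (0 : EuclideanSpace ℝ (Fin n)) R, ‖gradient u x‖ ≤ S := fun x hx =>
    le_csSup (bddAbove_norm_gradient hu hR1) ⟨x, hx, rfl⟩
  have hS0 : 0 ≤ S := (norm_nonneg _).trans (hSle 0 (mem_ball_self hRpos))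
  obtain ⟨L, hL, hLf⟩ := eMDeriv_eq_foldr β
  have hpow := sum_pow_sum_le β
  have hrpow : lam ^ ((∑ i, β i : ℝ) / 2) = Real.sqrt lam ^ (∑ i, β i) := by
    rw [Real.sqrt_eq_rpow, ← Real.rpow_natCast, ← Real.rpow_mul (by linarith)]
    push_cast
    ring_nf
  rw [hrpow, hLf]
  set k := ∑ i, β i with hk
  have hk1 : (1 : ℝ) ≤ k := by exact_mod_cast hβ
  obtain ⟨L', j, rfl⟩ : ∃ L' j, L = L' ++ [j] := by
    refine ⟨L.dropLast, L.getLast (List.ne_nil_of_length_pos (by omega)), ?_⟩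
    rw [List.dropLast_append_getLast]
  rw [List.foldr_append, List.foldr_cons, List.foldr_nil]
  have hlen : L'.length ≤ k := by
    rw [← hL]
    simp
  set d : ℝ := R / (2 * k) with hd
  have hdpos : 0 < d := by positivity
  have hdR : d ≤ R := div_le_self hRpos.le (by linarith)
  have hld : lam * d ^ 2 ≤ 1 := le_trans (by gcongr) hlR
  have hLd : L'.length * d < R := by
    calc L'.length * d ≤ k * d := by gcongr
      _ = R / 2 := by rw [hd]; field_simp
      _ < R := by linarith
  have hbase : (n + 2) / d = 4 * (n + 2) * k * Real.sqrt lam := by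
    rw [hd, hR]
    field_simp
    ring
  have hbase1 : 1 ≤ (n + 2) / d := by
    rw [hbase]
    have h1 : (1 : ℝ) ≤ 4 * (n + 2) := by
      have : (0 : ℝ) ≤ n := n.cast_nonneg
      linarith
    exact one_le_mul_of_one_le_of_one_le (one_le_mul_of_one_le_of_one_le h1 hk1) hsq1
  have key : ∀ M, 0 < M → S ≤ M →
      |L'.foldr ePDeriv (ePDeriv j u) 0| ≤ ((n + 2) / d) ^ k * M := by
    intro M hM hSM
    have hsub : closedBall (0 : EuclideanSpace ℝ (Fin n)) (0 + L'.length * d) ⊆ ball 0 R :=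
      closedBall_subset_ball (by linarith)
    have := (abs_foldr_ePDeriv_le isOpen_ball (hu.ePDeriv isOpen_ball j) (by linarith)
      (eLap_ePDeriv_add_mul_eq_zero isOpen_ball hu heq j) (p := 0) hdpos hld hM L').2.2 0 le_rfl
      (hsub.trans (ball_subset_ball hR1.le))
      (fun x hx => (abs_ePDeriv_le_norm_gradient u j x).trans ((hSle x (hsub hx)).trans hSM))
      0 (mem_closedBall_self le_rfl)
    refine this.trans ?_
    gcongr
  have key2 : |L'.foldr ePDeriv (ePDeriv j u) 0| ≤ ((n + 2) / d) ^ k * S := by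
    have ht : Filter.Tendsto (fun M => ((n + 2) / d) ^ k * M) (nhdsWithin S (Set.Ioi S))
        (nhds (((n + 2) / d) ^ k * S)) :=
      ((continuous_const.mul continuous_id).tendsto S).mono_left nhdsWithin_le_nhds
    refine ge_of_tendsto ht ?_
    filter_upwards [self_mem_nhdsWithin] with M hM
    exact key M (hS0.trans_lt hM) (le_of_lt hM)
  refine key2.trans (mul_le_mul_of_nonneg_right ?_ hS0)
  rw [hbase]
  calc (4 * (n + 2) * k * Real.sqrt lam) ^ k
      = (4 * (n + 2)) ^ k * Real.sqrt lam ^ k * (k : ℝ) ^ k := by simp only [mul_pow]; ring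
    _ ≤ (4 * (n + 2)) ^ k * Real.sqrt lam ^ k *
        ((Real.exp 1 * 2 ^ n) ^ k * (∏ i, (β i).factorial : ℕ)) := by gcongr
    _ = _ := by simp only [mul_pow]; ring
end
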